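/- arXiv:math/0701718 — 6 statements merged into one kernel-verified Lean document; each statement's English description precedes it below -/
import Mathlib

section
/- For every n ≥ 1, the poissonized and fixed-n expected numbers of occupied boxes satisfy 0 ≤ Φ_n − Φ(n) ≤ (2/n) Φ_2(n) ≤ (2/n) Φ(n). Consequently Φ_n − Φ(n) → 0 as n → ∞, and Φ_n ~ Φ(n), i.e. Φ_n/Φ(n) → 1 as n → ∞. -/
open Filter Topology

/-- Poissonized expected number of occupied boxes. -/
noncomputable def Phi (p : ℕ → ℝ) (t : ℝ) : ℝ := ∑' j, (1 - Real.exp (-t * p j))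

/-- Expected number of occupied boxes after `n` balls (fixed-`n` scheme). -/
noncomputable def PhiN (p : ℕ → ℝ) (n : ℕ) : ℝ := ∑' j, (1 - (1 - p j) ^ n)

/-- Poissonized expected number of boxes occupied by exactly `r` balls:
`Φ_r(t) = (t^r / r!) ∑_j p_j^r e^{-t p_j}`. -/
noncomputable def PhiR (p : ℕ → ℝ) (r : ℕ) (t : ℝ) : ℝ :=
  t ^ r / (Nat.factorial r) * ∑' j, p j ^ r * Real.exp (-t * p j)

/-- `0 ≤ Φ_n − Φ(n) ≤ (2/n) Φ_2(n) ≤ (2/n) Φ(n)`; consequently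
`Φ_n − Φ(n) → 0` and `Φ_n ∼ Φ(n)`. -/
theorem stmt_2 (p : ℕ → ℝ) (hpos : ∀ j, 0 < p j) (hmono : Antitone p)
    (hsum : ∑' j, p j = 1) :
    (∀ n : ℕ, 1 ≤ n →
      0 ≤ PhiN p n - Phi p n ∧
      PhiN p n - Phi p n ≤ 2 / (n : ℝ) * PhiR p 2 n ∧
      2 / (n : ℝ) * PhiR p 2 n ≤ 2 / (n : ℝ) * Phi p n) ∧
    Tendsto (fun n : ℕ => PhiN p n - Phi p n) atTop (𝓝 0) ∧
    Tendsto (fun n : ℕ => PhiN p n / Phi p n) atTop (𝓝 1) := by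
  have hs : Summable p := by
    by_contra h
    rw [tsum_eq_zero_of_not_summable h] at hsum
    norm_num at hsum
  have hp1 : ∀ j, p j ≤ 1 := fun j => by
    rw [← hsum]
    exact hs.le_tsum j (fun i _ => (hpos i).le)
  have hpow_lower : ∀ n : ℕ, ∀ j, 1 - n * p j ≤ (1 - p j) ^ n := fun n j => by
    have := one_add_mul_le_pow (a := -p j) (by linarith [hp1 j]) n
    rw [← sub_eq_add_neg] at this
    linarith
  have hpow_upper : ∀ n : ℕ, ∀ j, (1 - p j) ^ n ≤ Real.exp (-(n:ℝ) * p j) := fun n j => by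
    have h := pow_le_pow_left₀ (by linarith [hp1 j]) (Real.one_sub_le_exp_neg (p j)) n
    rw [← Real.exp_nat_mul] at h
    rwa [neg_mul, ← mul_neg]
  have hexp_le : ∀ n : ℕ, ∀ j, Real.exp (-(n:ℝ) * p j) ≤ 1 := fun n j => by
    rw [Real.exp_le_one_iff]
    have := mul_nonneg (Nat.cast_nonneg (α := ℝ) n) (hpos j).le
    linarith
  have hsN : ∀ n : ℕ, Summable (fun j => 1 - (1 - p j) ^ n) := fun n => by
    refine Summable.of_nonneg_of_le (fun j => ?_) (fun j => ?_) (hs.mul_left (n:ℝ))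
    · linarith [hpow_upper n j, hexp_le n j]
    · linarith [hpow_lower n j]
  have hsP : ∀ n : ℕ, Summable (fun j => 1 - Real.exp (-(n:ℝ) * p j)) := fun n => by
    refine Summable.of_nonneg_of_le (fun j => ?_) (fun j => ?_) (hsN n)
    · linarith [hexp_le n j]
    · linarith [hpow_upper n j]
  have hsR : ∀ n : ℕ, Summable (fun j => p j ^ 2 * Real.exp (-(n:ℝ) * p j)) := fun n => by
    refine Summable.of_nonneg_of_le (fun j => by positivity) (fun j => ?_) hs
    have h1 := hexp_le n j
    have h2 := hp1 j
    have h3 := hpos j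
    calc p j ^ 2 * Real.exp (-(n:ℝ) * p j) ≤ p j ^ 2 * 1 := by gcongr
      _ ≤ p j := by nlinarith
  have hR : ∀ n : ℕ, 1 ≤ n → 2 / (n:ℝ) * PhiR p 2 n
      = ∑' j, n * (p j ^ 2 * Real.exp (-(n:ℝ) * p j)) := fun n hn => by
    have : (n:ℝ) ≠ 0 := by positivity
    rw [tsum_mul_left, PhiR]
    simp only [Nat.factorial]
    field_simp
    norm_num
  have hkey : ∀ n : ℕ, ∀ j, Real.exp (-(n:ℝ) * p j) - (1 - p j) ^ n
      ≤ n * (p j ^ 2 * Real.exp (-(n:ℝ) * p j)) := fun n j => by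
    have h0 := hpos j
    have h1 := hp1 j
    have hb := one_add_mul_le_pow (a := -(p j ^ 2)) (by nlinarith) n
    have hc : (1 + -(p j ^ 2)) ^ n ≤ ((1 - p j) * Real.exp (p j)) ^ n := by
      apply pow_le_pow_left₀ (by nlinarith)
      have := mul_le_mul_of_nonneg_left (Real.add_one_le_exp (p j)) (sub_nonneg.2 h1)
      nlinarith
    rw [mul_pow, ← Real.exp_nat_mul] at hc
    have he : Real.exp ((n:ℝ) * p j) * Real.exp (-(n:ℝ) * p j) = 1 := by
      rw [← Real.exp_add]; simp
    have hd := mul_le_mul_of_nonneg_right (hb.trans hc) (Real.exp_pos (-(n:ℝ) * p j)).le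
    rw [mul_assoc, he] at hd
    linarith
  have hdiff : ∀ n : ℕ, PhiN p n - Phi p n
      = ∑' j, (Real.exp (-(n:ℝ) * p j) - (1 - p j) ^ n) := fun n => by
    rw [PhiN, Phi, ← (hsN n).tsum_sub (hsP n)]
    congr 1; ext j; ring
  have hsD : ∀ n : ℕ, Summable (fun j => Real.exp (-(n:ℝ) * p j) - (1 - p j) ^ n) := fun n => by
    refine ((hsN n).sub (hsP n)).congr (fun j => by ring)
  have hmain : ∀ n : ℕ, 1 ≤ n →
      0 ≤ PhiN p n - Phi p n ∧
      PhiN p n - Phi p n ≤ 2 / (n : ℝ) * PhiR p 2 n ∧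
      2 / (n : ℝ) * PhiR p 2 n ≤ 2 / (n : ℝ) * Phi p n := by
    intro n hn
    refine ⟨?_, ?_, ?_⟩
    · rw [hdiff]
      exact tsum_nonneg fun j => sub_nonneg.2 (hpow_upper n j)
    · rw [hdiff, hR n hn]
      exact (hsD n).tsum_le_tsum (hkey n) ((hsR n).mul_left _)
    · apply mul_le_mul_of_nonneg_left _ (by positivity)
      rw [PhiR, ← tsum_mul_left, Phi]
      refine ((hsR n).mul_left _).tsum_le_tsum (fun j => ?_) (hsP n)
      have hx : 0 ≤ (n:ℝ) * p j := mul_nonneg (Nat.cast_nonneg n) (hpos j).le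
      have hq := Real.quadratic_le_exp_of_nonneg hx
      have he : Real.exp ((n:ℝ) * p j) * Real.exp (-(n:ℝ) * p j) = 1 := by
        rw [← Real.exp_add]; simp
      have hd := mul_le_mul_of_nonneg_right hq (Real.exp_pos (-(n:ℝ) * p j)).le
      rw [he] at hd
      have hz := mul_nonneg hx (Real.exp_pos (-(n:ℝ) * p j)).le
      simp only [Nat.factorial]
      push_cast
      linarith
  have hPpos : ∀ n : ℕ, 1 ≤ n → 0 < Phi p n := fun n hn => by
    refine (hsP n).tsum_pos (fun j => sub_nonneg.2 (hexp_le n j)) 0 ?_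
    have : (0:ℝ) < n := by positivity
    have h2 := mul_pos this (hpos 0)
    rw [sub_pos, Real.exp_lt_one_iff]
    linarith
  refine ⟨hmain, ?_, ?_⟩
  · have hT : Tendsto (fun n : ℕ => ∑' j, n * (p j ^ 2 * Real.exp (-(n:ℝ) * p j))) atTop
        (𝓝 (∑' _ : ℕ, (0:ℝ))) := by
      refine tendsto_tsum_of_dominated_convergence hs (fun j => ?_) (Eventually.of_forall fun n j => ?_)
      · have h1 := (Real.tendsto_pow_mul_exp_neg_atTop_nhds_zero 1).comp
          ((tendsto_natCast_atTop_atTop (R := ℝ)).atTop_mul_const (hpos j))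
        have h2 := h1.const_mul (p j)
        rw [mul_zero] at h2
        refine h2.congr fun n => ?_
        simp only [Function.comp, neg_mul]
        ring
      · have h0 := hpos j
        rw [Real.norm_of_nonneg (by positivity)]
        have he : Real.exp ((n:ℝ) * p j) * Real.exp (-(n:ℝ) * p j) = 1 := by
          rw [← Real.exp_add]; simp
        have hd := mul_le_mul_of_nonneg_right (Real.add_one_le_exp ((n:ℝ) * p j))
          (Real.exp_pos (-(n:ℝ) * p j)).le
        rw [he] at hd
        have := Real.exp_pos (-(n:ℝ) * p j)
        have h5 : (n:ℝ) * p j * Real.exp (-(n:ℝ) * p j) ≤ 1 := by linarith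
        have := mul_le_mul_of_nonneg_left h5 h0.le
        linarith
    rw [tsum_zero] at hT
    refine tendsto_of_tendsto_of_tendsto_of_le_of_le' tendsto_const_nhds hT ?_ ?_
    · filter_upwards [eventually_ge_atTop 1] with n hn using (hmain n hn).1
    · filter_upwards [eventually_ge_atTop 1] with n hn
      rw [← hR n hn]
      exact (hmain n hn).2.1
  · have hU : Tendsto (fun n : ℕ => 1 + 2 / (n:ℝ)) atTop (𝓝 1) := by
      simpa using (tendsto_const_div_atTop_nhds_zero_nat (2:ℝ)).const_add 1
    refine tendsto_of_tendsto_of_tendsto_of_le_of_le' tendsto_const_nhds hU ?_ ?_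
    · filter_upwards [eventually_ge_atTop 1] with n hn
      rw [le_div_iff₀ (hPpos n hn)]
      linarith [(hmain n hn).1]
    · filter_upwards [eventually_ge_atTop 1] with n hn
      rw [div_le_iff₀ (hPpos n hn)]
      obtain ⟨_, h1, h2⟩ := hmain n hn
      linarith
end

section
/- For every fixed integer r ≥ 1 there exists a constant c > 0 such that for all n ≥ 1, |Φ_r(n) − Φ_{n,r}| ≤ (c/n) · max{Φ_r(n), Φ_{r+2}(n)}; in particular Φ_r(n) − Φ_{n,r} → 0 as n → ∞. -/
open Filter Topology

/-- Expected number of boxes containing exactly `r` of the first `n` balls: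
`Φ_{n,r} = C(n,r) ∑_j p_j^r (1-p_j)^{n-r}`. -/
noncomputable def PhiNR (p : ℕ → ℝ) (n r : ℕ) : ℝ :=
  (n.choose r : ℝ) * ∑' j, p j ^ r * (1 - p j) ^ (n - r)

lemma core_aux (r n : ℕ) (hr : 1 ≤ r) (hn : 1 ≤ n) (x : ℝ) (hx0 : 0 ≤ x) (hx1 : x ≤ 1) :
    |1 - ((n.descFactorial r : ℝ) / (n:ℝ)^r) * ((1 - x)^(n - r) * Real.exp (n * x))| ≤
      ((r:ℝ)^2 + 1 + r * Real.exp r) / n * (1 + (n * x)^2) := by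
  have hn0 : (0:ℝ) < n := by exact_mod_cast hn
  have hr1 : (1:ℝ) ≤ r := by exact_mod_cast hr
  have hE : 0 < Real.exp r := Real.exp_pos _
  have hEr : 0 ≤ (r:ℝ) * Real.exp r := by positivity
  rcases lt_or_ge n r with h | h
  · rw [Nat.descFactorial_of_lt h]
    simp only [Nat.cast_zero, zero_div, zero_mul, sub_zero, abs_one]
    have hnr : (n:ℝ) ≤ r := by exact_mod_cast h.le
    have h1 : 1 ≤ ((r:ℝ)^2 + 1 + r * Real.exp r) / n := by
      rw [le_div_iff₀ hn0]; nlinarith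
    nlinarith [sq_nonneg ((n:ℝ) * x)]
  · have hnr : (r:ℝ) ≤ n := by exact_mod_cast h
    set A := (n.descFactorial r : ℝ) / (n:ℝ)^r with hA
    set B := (1 - x)^(n - r) * Real.exp (n * x) with hB
    have hA0 : 0 ≤ A := by positivity
    have hA1 : A ≤ 1 := by
      rw [hA, div_le_one (by positivity)]
      exact_mod_cast Nat.descFactorial_le_pow n r
    have hx : 0 ≤ 1 - x := by linarith
    have hB0 : 0 ≤ B := by positivity
    have hA2 : 1 - (r:ℝ)^2 / n ≤ A := by
      have h1 : ((n + 1 - r : ℕ) : ℝ)^r ≤ n.descFactorial r := by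
        exact_mod_cast Nat.pow_sub_le_descFactorial n r
      rw [Nat.cast_sub (by omega)] at h1
      push_cast at h1
      have h2 := one_add_mul_le_pow (a := -(((r:ℝ) - 1) / n)) (by
        have : ((r:ℝ) - 1) / n ≤ 1 := by rw [div_le_one hn0]; linarith
        linarith) r
      have h3 : (1 + -(((r:ℝ) - 1) / n))^r = ((n:ℝ) + 1 - r)^r / (n:ℝ)^r := by
        rw [← div_pow]; congr 1; field_simp; ring
      rw [h3] at h2
      have h4 : ((n:ℝ) + 1 - r)^r / (n:ℝ)^r ≤ A := by
        rw [hA]; gcongr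
      have h5 : (r:ℝ) * (((r:ℝ) - 1) / n) ≤ (r:ℝ)^2 / n := by
        rw [← mul_div_assoc]; gcongr; nlinarith
      linarith
    have hB1 : 1 - n * x^2 ≤ B := by
      have h1 : (1 - x)^n ≤ (1 - x)^(n - r) :=
        pow_le_pow_of_le_one hx (by linarith) (Nat.sub_le _ _)
      have h2 : (1 - x)^n * Real.exp (n * x) ≤ B := by rw [hB]; gcongr
      rw [Real.exp_nat_mul, ← mul_pow] at h2
      have h3 : 1 - x^2 ≤ (1 - x) * Real.exp x := by
        nlinarith [Real.add_one_le_exp x]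
      have h5 : 0 ≤ 1 - x^2 := by nlinarith
      have h4 : (1 - x^2)^n ≤ ((1 - x) * Real.exp x)^n := by gcongr
      have h6 := one_add_mul_le_pow (a := -x^2) (by linarith) n
      have h7 : 1 + -x^2 = 1 - x^2 := by ring
      rw [h7] at h6
      linarith
    have hB2 : B ≤ 1 + r * x * Real.exp r := by
      have h1 : (1 - x)^(n - r) ≤ Real.exp (-x)^(n - r) := by
        gcongr; exact Real.one_sub_le_exp_neg x
      rw [← Real.exp_nat_mul, Nat.cast_sub h] at h1
      have h2 : B ≤ Real.exp (r * x) := by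
        calc B ≤ Real.exp (((n:ℝ) - r) * -x) * Real.exp (n * x) := by rw [hB]; gcongr
          _ = Real.exp (r * x) := by rw [← Real.exp_add]; congr 1; ring
      have h3 : 1 - r * x ≤ Real.exp (-(r * x)) := Real.one_sub_le_exp_neg _
      have h4 : Real.exp (r * x) * Real.exp (-(r*x)) = 1 := by
        rw [← Real.exp_add]; simp
      have h5 : Real.exp (r * x) ≤ Real.exp r := by
        apply Real.exp_le_exp.2; nlinarith
      have h6 : 0 < Real.exp (r * x) := Real.exp_pos _
      have h7 : r * x * Real.exp (r*x) ≤ r * x * Real.exp r := by gcongr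
      nlinarith
    have hrhs : ((r:ℝ)^2 + 1 + r * Real.exp r) / n * (1 + (n * x)^2)
        = (r:ℝ)^2 / n * (1 + (n*x)^2) + (1 / n + n * x^2)
          + r * Real.exp r * ((1 + (n * x)^2) / n) := by
      field_simp
    have e1 : 0 ≤ (r:ℝ)^2 / n * (n*x)^2 := by positivity
    have e2 : 0 ≤ 1 / (n:ℝ) := by positivity
    have e3 : 0 ≤ r * Real.exp r * ((1 + (n * x)^2) / n) := by positivity
    have e4 : x ≤ (1 + (n * x)^2) / n := by
      rw [le_div_iff₀ hn0]; nlinarith [sq_nonneg ((n:ℝ) * x - 1)]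
    have e5 : r * Real.exp r * x ≤ r * Real.exp r * ((1 + (n * x)^2) / n) := by gcongr
    have e6 : 0 ≤ n * x^2 := by positivity
    have e7 : 0 ≤ (r:ℝ)^2 / n := by positivity
    rw [hrhs, abs_le]
    constructor
    · have : A * B ≤ B := by nlinarith
      nlinarith
    · have : A * (1 - B) ≤ n * x^2 := by
        have : A * (1 - B) ≤ A * (n * x^2) := by gcongr; linarith
        nlinarith
      nlinarith

lemma key_aux (r n : ℕ) (hr : 1 ≤ r) (hn : 1 ≤ n) (x : ℝ) (hx0 : 0 ≤ x) (hx1 : x ≤ 1) :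
    |(n:ℝ)^r / r.factorial * (x^r * Real.exp (-n * x))
        - n.choose r * (x^r * (1 - x)^(n - r))| ≤
      ((r:ℝ)^2 + 1 + r * Real.exp r) / n *
        ((n:ℝ)^r / r.factorial * (x^r * Real.exp (-n * x)) +
          ((r:ℝ)+1) * (r + 2) *
          ((n:ℝ)^(r+2) / (r+2).factorial * (x^(r+2) * Real.exp (-n * x)))) := by
  have hn0 : (0:ℝ) < n := by exact_mod_cast hn
  have hf : (0:ℝ) < r.factorial := by exact_mod_cast r.factorial_pos
  have hch : (n.choose r : ℝ) = n.descFactorial r / r.factorial := by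
    rw [eq_div_iff hf.ne', Nat.descFactorial_eq_factorial_mul_choose]; push_cast; ring
  have hex : Real.exp (n * x) * Real.exp (-n * x) = 1 := by
    rw [← Real.exp_add]; simp
  have hf2 : ((r+2).factorial : ℝ) = (r+2) * ((r+1) * r.factorial) := by
    rw [Nat.factorial_succ, Nat.factorial_succ]; push_cast; ring
  have h := core_aux r n hr hn x hx0 hx1
  set T := (n:ℝ)^r / r.factorial * (x^r * Real.exp (-n * x)) with hT
  have hT0 : 0 ≤ T := by positivity
  have e1 : T - n.choose r * (x^r * (1 - x)^(n - r)) =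
      T * (1 - ((n.descFactorial r : ℝ) / (n:ℝ)^r) * ((1 - x)^(n - r) * Real.exp (n * x))) := by
    rw [mul_sub, mul_one, hT, hch]
    congr 1
    clear h hT hT0
    generalize Real.exp (-(n:ℝ) * x) = v at hex ⊢
    generalize Real.exp ((n:ℝ) * x) = u at hex ⊢
    field_simp
    linear_combination (-(n.descFactorial r : ℝ) * x^r * (1-x)^(n-r)) * hex
  have e2 : ((r:ℝ)+1) * (r + 2) *
          ((n:ℝ)^(r+2) / (r+2).factorial * (x^(r+2) * Real.exp (-n * x))) = T * (n*x)^2 := by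
    rw [hf2, hT]; field_simp; ring
  rw [e1, e2, abs_mul, abs_of_nonneg hT0]
  calc _ ≤ T * (((r:ℝ)^2 + 1 + r * Real.exp r) / n * (1 + (n * x)^2)) := by gcongr
    _ = _ := by ring

lemma pow_exp_aux (s : ℕ) (y : ℝ) (hy : 0 ≤ y) : y^s * Real.exp (-y) ≤ s.factorial := by
  have h := Real.pow_div_factorial_le_exp y hy s
  have hf : (0:ℝ) < s.factorial := by exact_mod_cast s.factorial_pos
  rw [div_le_iff₀ hf] at h
  rw [Real.exp_neg, ← div_eq_mul_inv, div_le_iff₀ (Real.exp_pos _)]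
  linarith

lemma summ_aux (p q : ℕ → ℝ) (hp : Summable p) (hpos : ∀ j, 0 < p j) (h1 : ∀ j, p j ≤ 1)
    (r : ℕ) (hr : 1 ≤ r) (hq0 : ∀ j, 0 ≤ q j) (hq1 : ∀ j, q j ≤ 1) :
    Summable (fun j => p j ^ r * q j) := by
  refine Summable.of_nonneg_of_le (fun j => mul_nonneg (pow_nonneg (hpos j).le _) (hq0 j))
    (fun j => ?_) hp
  calc p j ^ r * q j ≤ p j ^ r * 1 := by
        gcongr
        · exact pow_nonneg (hpos j).le _
        · exact hq1 j
    _ = p j ^ r := mul_one _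
    _ ≤ p j := pow_le_of_le_one (hpos j).le (h1 j) (by omega)

lemma lim_aux (p : ℕ → ℝ) (hp : Summable p) (hpos : ∀ j, 0 < p j) (s : ℕ) :
    Tendsto (fun n : ℕ => PhiR p (s+1) n / n) atTop (𝓝 0) := by
  have h := tendsto_tsum_of_dominated_convergence (𝓕 := (atTop : Filter ℕ))
    (f := fun (n : ℕ) (j : ℕ) => p j * (((n:ℝ) * p j)^s * Real.exp (-(n * p j))))
    (g := fun _ => (0:ℝ)) (bound := fun j => p j * s.factorial) (hp.mul_right _)
    (fun j => by
      have h1 := (Real.tendsto_pow_mul_exp_neg_atTop_nhds_zero s).comp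
        (tendsto_natCast_atTop_atTop.atTop_mul_const (hpos j))
      simpa using h1.const_mul (p j))
    (Eventually.of_forall fun n j => by
      have h0 := (hpos j).le
      rw [Real.norm_of_nonneg (by positivity)]
      gcongr
      exact pow_exp_aux s _ (by positivity))
  simp only [tsum_zero] at h
  have h2 := h.const_mul (1 / ((s+1).factorial : ℝ))
  rw [mul_zero] at h2
  refine h2.congr' ?_
  filter_upwards [eventually_ge_atTop 1] with n hn
  have hn0 : (0:ℝ) < n := by exact_mod_cast hn
  unfold PhiR
  rw [mul_div_right_comm, ← tsum_mul_left, ← tsum_mul_left]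
  refine tsum_congr fun j => ?_
  rw [neg_mul]
  field_simp
  ring

theorem stmt_3 (p : ℕ → ℝ) (hpos : ∀ j, 0 < p j) (hmono : Antitone p)
    (hsum : ∑' j, p j = 1) :
    ∀ r : ℕ, 1 ≤ r → ∃ c : ℝ, 0 < c ∧
      (∀ n : ℕ, 1 ≤ n →
        |PhiR p r n - PhiNR p n r| ≤
          c / (n : ℝ) * max (PhiR p r n) (PhiR p (r + 2) n)) ∧
      Tendsto (fun n : ℕ => PhiR p r n - PhiNR p n r) atTop (𝓝 0) := by
  intro r hr
  have hp : Summable p := by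
    by_contra h
    rw [tsum_eq_zero_of_not_summable h] at hsum
    exact zero_ne_one hsum
  have h1 : ∀ j, p j ≤ 1 := fun j => hsum ▸ hp.le_tsum j (fun i _ => (hpos i).le)
  have hexp : ∀ (n : ℕ) (s : ℕ), 1 ≤ s →
      Summable (fun j => p j ^ s * Real.exp (-(n:ℝ) * p j)) := fun n s hs =>
    summ_aux p _ hp hpos h1 s hs (fun j => (Real.exp_pos _).le) (fun j => by
      rw [Real.exp_le_one_iff]
      have := (hpos j).le
      have : (0:ℝ) ≤ n * p j := by positivity
      linarith)
  set C : ℝ := (r:ℝ)^2 + 1 + r * Real.exp r with hC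
  have hC0 : 0 < C := by positivity
  set K : ℝ := ((r:ℝ)+1) * (r + 2) with hK
  have hK0 : 0 < K := by positivity
  have main : ∀ n : ℕ, 1 ≤ n → |PhiR p r n - PhiNR p n r| ≤
      C / n * (PhiR p r n + K * PhiR p (r+2) n) := by
    intro n hn
    have s1 := (hexp n r hr).mul_left ((n:ℝ)^r / r.factorial)
    have s2 := (hexp n (r+2) (by omega)).mul_left ((n:ℝ)^(r+2) / (r+2).factorial)
    have s3 := (summ_aux p (fun j => (1 - p j)^(n - r)) hp hpos h1 r hr
      (fun j => pow_nonneg (by linarith [h1 j]) _)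
      (fun j => pow_le_one₀ (by linarith [h1 j]) (by linarith [hpos j]))).mul_left (n.choose r : ℝ)
    have hs := ((s1.add (s2.mul_left K)).mul_left (C / n))
    have hb := tsum_of_norm_bounded (f := fun j => (n:ℝ)^r / r.factorial * (p j^r * Real.exp (-n * p j))
        - n.choose r * (p j^r * (1 - p j)^(n - r))) hs.hasSum
      (fun j => key_aux r n hr hn (p j) (hpos j).le (h1 j))
    rw [s1.tsum_sub s3, tsum_mul_left, tsum_mul_left, tsum_mul_left,
      s1.tsum_add (s2.mul_left K), tsum_mul_left, tsum_mul_left, tsum_mul_left] at hb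
    exact hb
  refine ⟨C * (1 + K), by positivity, fun n hn => (main n hn).trans ?_, ?_⟩
  · have hn0 : (0:ℝ) < n := by exact_mod_cast hn
    have a1 := le_max_left (PhiR p r n) (PhiR p (r+2) n)
    have a2 := le_max_right (PhiR p r n) (PhiR p (r+2) n)
    calc _ ≤ C / n * (max (PhiR p r n) (PhiR p (r+2) n)
          + K * max (PhiR p r n) (PhiR p (r+2) n)) := by gcongr
      _ = _ := by ring
  · obtain ⟨s, rfl⟩ : ∃ s, r = s + 1 := ⟨r - 1, by omega⟩
    have l := ((lim_aux p hp hpos s).add ((lim_aux p hp hpos (s+2)).const_mul K)).const_mul C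
    simp only [mul_zero, add_zero] at l
    refine squeeze_zero_norm' ?_ l
    filter_upwards [eventually_ge_atTop 1] with n hn
    refine (main n hn).trans (le_of_eq ?_)
    rw [show s + 1 + 2 = s + 2 + 1 by ring]
    ring
end

section
/- Let φ(t) = ∑_j p_j e^{−t p_j}. Then φ(t)² / φ(2t) → 0 as t → ∞. Consequently Φ_1(t)² / (t V(t)) → 0 as t → ∞, where Φ_1(t) = t φ(t) and V(t) = Φ(2t) − Φ(t). -/
open Filter Topology

/-- `φ(t) = Φ'(t) = ∑_j p_j e^{-t p_j}`. -/
noncomputable def phi (p : ℕ → ℝ) (t : ℝ) : ℝ := ∑' j, p j * Real.exp (-t * p j)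

lemma aux_cs (a e : ℕ → ℝ) (ha : ∀ j, 0 < a j) (hs : Summable a)
    (h1 : Summable fun j => a j * e j) (h2 : Summable fun j => a j * (e j) ^ 2) :
    (∑' j, a j * e j) ^ 2 ≤ (∑' j, a j) * ∑' j, a j * (e j) ^ 2 := by
  have hP : 0 < ∑' j, a j := hs.tsum_pos (fun j => (ha j).le) 0 (ha 0)
  set P := ∑' j, a j with hPd
  set b := ∑' j, a j * e j with hb
  set Q := ∑' j, a j * (e j) ^ 2 with hQ
  have key : HasSum (fun j => a j * (P * e j - b) ^ 2) (P ^ 2 * Q - 2 * P * b * b + b ^ 2 * P) := by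
    have := ((h2.hasSum.mul_left (P ^ 2)).sub (h1.hasSum.mul_left (2 * P * b))).add
      (hs.hasSum.mul_left (b ^ 2))
    have hf : (fun j => a j * (P * e j - b) ^ 2) = fun j =>
        P ^ 2 * (a j * (e j) ^ 2) - 2 * P * b * (a j * e j) + b ^ 2 * a j := by
      funext j; ring
    rw [hf]
    exact this
  have h0 : 0 ≤ P ^ 2 * Q - 2 * P * b * b + b ^ 2 * P :=
    key.nonneg (fun j => mul_nonneg (ha j).le (sq_nonneg _))
  have : 0 ≤ P * (P * Q - b ^ 2) := by nlinarith
  have := nonneg_of_mul_nonneg_right this hP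
  linarith

lemma aux_summable (p : ℕ → ℝ) (hpos : ∀ j, 0 < p j) (hs : Summable p) (t : ℝ) (ht : 0 ≤ t) :
    Summable fun j => p j * Real.exp (-t * p j) := by
  refine Summable.of_nonneg_of_le (fun j => mul_nonneg (hpos j).le (Real.exp_pos _).le)
    (fun j => ?_) hs
  have : Real.exp (-t * p j) ≤ 1 := Real.exp_le_one_iff.2 (by nlinarith [mul_nonneg ht (hpos j).le])
  exact mul_le_of_le_one_right (hpos j).le this

lemma aux_phi_pos (p : ℕ → ℝ) (hpos : ∀ j, 0 < p j) (hs : Summable p) (t : ℝ) (ht : 0 ≤ t) :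
    0 < phi p t :=
  (aux_summable p hpos hs t ht).tsum_pos (fun j => mul_nonneg (hpos j).le (Real.exp_pos _).le) 0
    (mul_pos (hpos 0) (Real.exp_pos _))

lemma aux_bound (p : ℕ → ℝ) (hpos : ∀ j, 0 < p j) (hmono : Antitone p)
    (hsum : ∑' j, p j = 1) (hs : Summable p) (N M : ℕ) (t : ℝ) (ht : 0 ≤ t) :
    (phi p t) ^ 2 / phi p (2 * t) ≤
      2 / p M * Real.exp (-(2 * (p N - p M)) * t) + 2 * ∑' j, p (j + N) := by
  have hφ := aux_phi_pos p hpos hs (2 * t) (by linarith)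
  have s1 := aux_summable p hpos hs t ht
  have s2 := aux_summable p hpos hs (2 * t) (by linarith)
  have hsplit := s1.sum_add_tsum_nat_add N
  have hsplit2 := s2.sum_add_tsum_nat_add N
  have hE : ∀ x : ℝ, (Real.exp (-t * x)) ^ 2 = Real.exp (-(2 * t) * x) := by
    intro x
    rw [← Real.exp_nat_mul]; congr 1; push_cast; ring
  have cs := aux_cs (fun j => p (j + N)) (fun j => Real.exp (-t * p (j + N))) (fun j => hpos _)
    ((summable_nat_add_iff N).2 hs) ((summable_nat_add_iff N).2 s1)
    (by simp only [hE]; exact (summable_nat_add_iff N).2 s2)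
  simp only [hE] at cs
  have hhead0 : 0 ≤ ∑ j ∈ Finset.range N, p j * Real.exp (-t * p j) :=
    Finset.sum_nonneg fun j _ => mul_nonneg (hpos j).le (Real.exp_pos _).le
  have hhead : ∑ j ∈ Finset.range N, p j * Real.exp (-t * p j) ≤ Real.exp (-t * p N) := by
    calc _ ≤ ∑ j ∈ Finset.range N, p j * Real.exp (-t * p N) := by
          refine Finset.sum_le_sum fun j hj => ?_
          have : p N ≤ p j := hmono (Finset.mem_range.1 hj).le
          refine mul_le_mul_of_nonneg_left (Real.exp_le_exp.2 ?_) (hpos j).le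
          nlinarith [mul_le_mul_of_nonneg_left this ht]
      _ = (∑ j ∈ Finset.range N, p j) * Real.exp (-t * p N) := by rw [Finset.sum_mul]
      _ ≤ 1 * Real.exp (-t * p N) := by
          refine mul_le_mul_of_nonneg_right ?_ (Real.exp_pos _).le
          rw [← hsum]
          exact hs.sum_le_tsum _ (fun j _ => (hpos j).le)
      _ = _ := one_mul _
  have hhead2 : (∑ j ∈ Finset.range N, p j * Real.exp (-t * p j)) ^ 2
      ≤ Real.exp (-(2 * t) * p N) := by
    rw [← hE]; exact pow_le_pow_left₀ hhead0 hhead 2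
  have hM : p M * Real.exp (-(2 * t) * p M) ≤ phi p (2 * t) :=
    s2.le_tsum M (fun j _ => mul_nonneg (hpos j).le (Real.exp_pos _).le)
  have hQ : ∑' j, p (j + N) * Real.exp (-(2 * t) * p (j + N)) ≤ phi p (2 * t) := by
    have : 0 ≤ ∑ j ∈ Finset.range N, p j * Real.exp (-(2 * t) * p j) :=
      Finset.sum_nonneg fun j _ => mul_nonneg (hpos j).le (Real.exp_pos _).le
    unfold phi
    linarith
  have hP : 0 ≤ ∑' j, p (j + N) := tsum_nonneg fun j => (hpos _).le
  rw [div_le_iff₀ hφ, add_mul]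
  have e1 : 2 * Real.exp (-(2 * t) * p N) ≤
      2 / p M * Real.exp (-(2 * (p N - p M)) * t) * phi p (2 * t) := by
    have hpM := hpos M
    calc _ = 2 / p M * Real.exp (-(2 * (p N - p M)) * t) *
            (p M * Real.exp (-(2 * t) * p M)) := by
          have : Real.exp (-(2 * t) * p N) = Real.exp (-(2 * (p N - p M)) * t) *
            Real.exp (-(2 * t) * p M) := by
            rw [← Real.exp_add]; congr 1; ring
          rw [this]; field_simp
      _ ≤ _ := mul_le_mul_of_nonneg_left hM (by positivity)
  have e2 := mul_le_mul_of_nonneg_left hQ hP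
  have e3 : phi p t = ∑ j ∈ Finset.range N, p j * Real.exp (-t * p j) +
    ∑' j, p (j + N) * Real.exp (-t * p (j + N)) := hsplit.symm
  rw [e3]
  nlinarith [sq_nonneg (∑ j ∈ Finset.range N, p j * Real.exp (-t * p j) -
    ∑' j, p (j + N) * Real.exp (-t * p (j + N)))]

lemma aux_V (p : ℕ → ℝ) (hpos : ∀ j, 0 < p j) (hs : Summable p) (t : ℝ) (ht : 0 ≤ t) :
    t * phi p (2 * t) ≤ Phi p (2 * t) - Phi p t := by
  have hS : ∀ u : ℝ, 0 ≤ u → Summable fun j => 1 - Real.exp (-u * p j) := by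
    intro u hu
    refine Summable.of_nonneg_of_le (fun j => ?_) (fun j => ?_) (hs.mul_left u)
    · have : Real.exp (-u * p j) ≤ 1 :=
        Real.exp_le_one_iff.2 (by nlinarith [mul_nonneg hu (hpos j).le])
      linarith
    · have := Real.add_one_le_exp (-u * p j)
      linarith
  have h2 : 0 ≤ 2 * t := by linarith
  unfold Phi phi
  rw [← (hS _ h2).tsum_sub (hS t ht), ← tsum_mul_left]
  refine Summable.tsum_le_tsum (fun j => ?_) ((aux_summable p hpos hs _ h2).mul_left t)
    ((hS _ h2).sub (hS t ht))
  have h := Real.add_one_le_exp (t * p j)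
  have e1 : Real.exp (-t * p j) = Real.exp (-(2 * t) * p j) * Real.exp (t * p j) := by
    rw [← Real.exp_add]; congr 1; ring
  rw [e1]
  nlinarith [mul_le_mul_of_nonneg_left h (Real.exp_pos (-(2 * t) * p j)).le]

/-- `φ(t)²/φ(2t) → 0`, and consequently `Φ_1(t)²/(t V(t)) → 0`, where
`Φ_1(t) = t φ(t)` and `V(t) = Φ(2t) − Φ(t)`. -/
theorem stmt_8 (p : ℕ → ℝ) (hpos : ∀ j, 0 < p j) (hmono : Antitone p)
    (hsum : ∑' j, p j = 1) :
    Tendsto (fun t : ℝ => (phi p t) ^ 2 / phi p (2 * t)) atTop (𝓝 0) ∧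
    Tendsto
      (fun t : ℝ => (t * phi p t) ^ 2 / (t * (Phi p (2 * t) - Phi p t)))
      atTop (𝓝 0) := by
  have hs : Summable p := by
    by_contra h
    rw [tsum_eq_zero_of_not_summable h] at hsum
    exact zero_ne_one hsum
  have main : Tendsto (fun t : ℝ => (phi p t) ^ 2 / phi p (2 * t)) atTop (𝓝 0) := by
    have hnn : ∀ t : ℝ, 0 ≤ t → 0 ≤ (phi p t) ^ 2 / phi p (2 * t) := fun t ht =>
      div_nonneg (sq_nonneg _) (aux_phi_pos p hpos hs _ (by linarith)).le
    rw [Metric.tendsto_nhds]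
    intro ε hε
    obtain ⟨N, hN⟩ := ((tendsto_sum_nat_add p).eventually
      (gt_mem_nhds (show (0 : ℝ) < ε / 4 by positivity))).exists
    obtain ⟨M, hM⟩ := (hs.tendsto_atTop_zero.eventually (gt_mem_nhds (hpos N))).exists
    have hc : 0 < 2 * (p N - p M) := by linarith
    have hlim : Tendsto (fun t : ℝ => 2 / p M * Real.exp (-(2 * (p N - p M)) * t))
        atTop (𝓝 0) := by
      have h1 : Tendsto (fun t : ℝ => -(2 * (p N - p M)) * t) atTop atBot :=
        tendsto_id.const_mul_atTop_of_neg (by linarith)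
      simpa using (Real.tendsto_exp_atBot.comp h1).const_mul (2 / p M)
    filter_upwards [hlim.eventually (gt_mem_nhds (show (0 : ℝ) < ε / 2 by positivity)),
      eventually_ge_atTop 0] with t h1 ht
    have hb := aux_bound p hpos hmono hsum hs N M t ht
    rw [Real.dist_eq, sub_zero, abs_of_nonneg (hnn t ht)]
    linarith
  refine ⟨main, ?_⟩
  refine tendsto_of_tendsto_of_tendsto_of_le_of_le' tendsto_const_nhds main ?_ ?_
  · filter_upwards [eventually_gt_atTop 0] with t ht
    have hV := aux_V p hpos hs t ht.le
    have hφ := aux_phi_pos p hpos hs (2 * t) (by linarith)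
    have : 0 < Phi p (2 * t) - Phi p t := lt_of_lt_of_le (mul_pos ht hφ) hV
    positivity
  · filter_upwards [eventually_gt_atTop 0] with t ht
    have hV := aux_V p hpos hs t ht.le
    have hφ := aux_phi_pos p hpos hs (2 * t) (by linarith)
    calc _ ≤ (t * phi p t) ^ 2 / (t * (t * phi p (2 * t))) := by gcongr
      _ = _ := by field_simp
end

section
/- Each of the following conditions implies V(t) → ∞ as t → ∞: (i) ∇ν(x) := ν̄(x/2) − ν̄(x) = #{j : x/2 ≤ p_j < x} → ∞ as x → 0+; (ii) for every integer k ≥ 1, liminf_{j→∞} p_{j+k}/p_j ≥ 1/2; (iii) p_j / (∑_{i ≥ j} p_i) → 0 as j → ∞. -/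
open Filter Topology

/-- Poissonized variance `V(t) = Φ(2t) − Φ(t)`. -/
noncomputable def Vpois (p : ℕ → ℝ) (t : ℝ) : ℝ := Phi p (2 * t) - Phi p t

theorem s11_summable (p : ℕ → ℝ) (hsum : ∑' j, p j = 1) : Summable p := by
  by_contra h
  rw [tsum_eq_zero_of_not_summable h] at hsum
  norm_num at hsum

theorem s11_summable_exp (p : ℕ → ℝ) (hpos : ∀ j, 0 < p j) (hs : Summable p) (t : ℝ)
    (ht : 0 ≤ t) : Summable (fun j => 1 - Real.exp (-t * p j)) := by
  refine Summable.of_nonneg_of_le (fun j => ?_) (fun j => ?_) (hs.mul_left t)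
  · have : Real.exp (-t * p j) ≤ 1 := by
      rw [Real.exp_le_one_iff]
      have := mul_nonneg ht (hpos j).le
      linarith
    linarith
  · have := Real.add_one_le_exp (-t * p j)
    linarith

theorem s11_pt (u : ℝ) (h0 : 0 ≤ u) :
    0 ≤ Real.exp (-u) * (1 - Real.exp (-u)) ∧
    (u ≤ 1 → u / 6 ≤ Real.exp (-u) * (1 - Real.exp (-u))) := by
  have hle : Real.exp (-u) ≤ 1 := by rw [Real.exp_le_one_iff]; linarith
  have hp := Real.exp_pos (-u)
  refine ⟨mul_nonneg hp.le (by linarith), fun h1 => ?_⟩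
  have h3 : (1 / 3 : ℝ) ≤ Real.exp (-u) := by
    rw [Real.exp_neg, ← one_div]
    apply one_div_le_one_div_of_le (Real.exp_pos u)
    have : Real.exp u ≤ Real.exp 1 := Real.exp_le_exp.mpr h1
    have := Real.exp_one_lt_d9
    linarith
  have h4 : u / 2 ≤ 1 - Real.exp (-u) := by
    have h5 := Real.add_one_le_exp u
    have h6 : Real.exp (-u) * Real.exp u = 1 := by rw [← Real.exp_add]; simp
    have h7 : Real.exp (-u) * (u + 1) ≤ 1 := by
      exact (mul_le_mul_of_nonneg_left h5 hp.le).trans h6.le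
    nlinarith
  calc u / 6 = (1 / 3) * (u / 2) := by ring
    _ ≤ _ := mul_le_mul h3 h4 (by linarith) hp.le

theorem s11_key (p : ℕ → ℝ) (hpos : ∀ j, 0 < p j) (hs : Summable p) (t : ℝ)
    (ht : 0 < t) (S : Finset ℕ) (hS : ∀ i ∈ S, t * p i ≤ 1) :
    ∑ i ∈ S, t * p i / 6 ≤ Vpois p t := by
  have e1 := s11_summable_exp p hpos hs t ht.le
  have e2 := s11_summable_exp p hpos hs (2 * t) (by linarith)
  have hf : ∀ j, (1 - Real.exp (-(2 * t) * p j)) - (1 - Real.exp (-t * p j))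
      = Real.exp (-(t * p j)) * (1 - Real.exp (-(t * p j))) := by
    intro j
    have : Real.exp (-(2 * t) * p j) = Real.exp (-(t * p j)) * Real.exp (-(t * p j)) := by
      rw [← Real.exp_add]; congr 1; ring
    rw [this, neg_mul]; ring
  have hV : Vpois p t = ∑' j, Real.exp (-(t * p j)) * (1 - Real.exp (-(t * p j))) := by
    unfold Vpois Phi
    rw [← e2.tsum_sub e1]
    exact tsum_congr hf
  have hsm : Summable fun j => Real.exp (-(t * p j)) * (1 - Real.exp (-(t * p j))) :=
    (e2.sub e1).congr (fun j => hf j)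
  rw [hV]
  have hu : ∀ j, 0 ≤ t * p j := fun j => mul_nonneg ht.le (hpos j).le
  refine le_trans (Finset.sum_le_sum fun i hi => (s11_pt _ (hu i)).2 (hS i hi)) ?_
  exact hsm.sum_le_tsum S (fun i _ => (s11_pt _ (hu i)).1)

theorem s11_index (p : ℕ → ℝ) (hpos : ∀ j, 0 < p j) (hmono : Antitone p) (hs : Summable p)
    (N : ℕ) : ∀ᶠ t : ℝ in atTop, 0 < t ∧ ∃ m, N ≤ m ∧ 1 < t * p m ∧ t * p (m + 1) ≤ 1 := by
  filter_upwards [eventually_gt_atTop (1 / p N)] with t ht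
  have ht0 : 0 < t := lt_trans (one_div_pos.mpr (hpos N)) ht
  rw [div_lt_iff₀ (hpos N)] at ht
  refine ⟨ht0, ?_⟩
  have hex : ∃ j, t * p j ≤ 1 := by
    have h := (hs.tendsto_atTop_zero.const_mul t)
    rw [mul_zero] at h
    exact (h.eventually_le_const one_pos).exists
  classical
  have hj := Nat.find_spec hex
  have hmin := fun m => @Nat.find_min _ _ hex m
  generalize Nat.find hex = j at hj hmin
  have hNj : N < j := by
    by_contra hc
    have := mul_le_mul_of_nonneg_left (hmono (not_lt.mp hc)) ht0.le
    linarith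
  obtain ⟨m, rfl⟩ : ∃ m, j = m + 1 := ⟨j - 1, by omega⟩
  exact ⟨m, by omega, not_le.mp (hmin m (by omega)), hj⟩

/-- Each of the conditions (i) `∇ν(x) = #{j : x/2 ≤ p_j < x} → ∞` as `x → 0+`;
(ii) `liminf_j p_{j+k}/p_j ≥ 1/2` for every `k ≥ 1`;
(iii) `p_j / ∑_{i ≥ j} p_i → 0` — implies `V(t) → ∞`. -/
theorem stmt_11 (p : ℕ → ℝ) (hpos : ∀ j, 0 < p j) (hmono : Antitone p)
    (hsum : ∑' j, p j = 1) :
    (Tendsto (fun x : ℝ => ({j | x / 2 ≤ p j ∧ p j < x}.ncard : ℕ)) (𝓝[>] 0) atTop →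
      Tendsto (Vpois p) atTop atTop) ∧
    ((∀ k : ℕ, 1 ≤ k → (1 : ℝ) / 2 ≤ liminf (fun j : ℕ => p (j + k) / p j) atTop) →
      Tendsto (Vpois p) atTop atTop) ∧
    (Tendsto (fun j : ℕ => p j / ∑' i : ℕ, p (j + i)) atTop (𝓝 0) →
      Tendsto (Vpois p) atTop atTop) := by
  have hs := s11_summable p hsum
  refine ⟨fun h => ?_, fun h => ?_, fun h => ?_⟩
  · rw [tendsto_atTop]
    intro b
    obtain ⟨n, hn⟩ := exists_nat_ge (12 * b)
    have h2 := tendsto_inv_atTop_nhdsGT_zero.eventually (h.eventually_ge_atTop (n + 1))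
    filter_upwards [h2, eventually_gt_atTop (0 : ℝ)] with t hcard ht
    have hfin := Set.finite_of_ncard_pos (lt_of_lt_of_le (Nat.succ_pos n) hcard)
    rw [Set.ncard_eq_toFinset_card _ hfin] at hcard
    have hmem : ∀ i ∈ hfin.toFinset, 1 / 2 ≤ t * p i ∧ t * p i ≤ 1 := by
      intro i hi
      rw [Set.Finite.mem_toFinset] at hi
      obtain ⟨ha, hb⟩ := hi
      have h3 := mul_le_mul_of_nonneg_left ha ht.le
      have h4 := mul_le_mul_of_nonneg_left hb.le ht.le
      have h5 : t * t⁻¹ = 1 := mul_inv_cancel₀ ht.ne'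
      exact ⟨by linarith, by linarith⟩
    have hk := s11_key p hpos hs t ht _ (fun i hi => (hmem i hi).2)
    have h6 := Finset.card_nsmul_le_sum hfin.toFinset (fun i => t * p i / 6) (1 / 12)
      (fun i hi => by have := (hmem i hi).1; linarith)
    rw [nsmul_eq_mul] at h6
    have h7 : ((n + 1 : ℕ) : ℝ) ≤ (hfin.toFinset.card : ℝ) := by exact_mod_cast hcard
    push_cast at h7
    linarith
  · rw [tendsto_atTop]
    intro b
    obtain ⟨n, hn⟩ := exists_nat_ge (18 * b)
    have h1 : (1 / 3 : ℝ) < liminf (fun j : ℕ => p (j + (n + 1)) / p j) atTop :=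
      lt_of_lt_of_le (by norm_num) (h (n + 1) (by omega))
    have h2 := eventually_lt_of_lt_liminf h1
      (isBoundedUnder_of ⟨0, fun j => (div_pos (hpos _) (hpos _)).le⟩)
    obtain ⟨N, hN⟩ := eventually_atTop.mp h2
    filter_upwards [s11_index p hpos hmono hs N] with t ⟨ht, m, hm, hm1, hm2⟩
    have h3 := hN m hm
    rw [lt_div_iff₀ (hpos m)] at h3
    have hk := s11_key p hpos hs t ht (Finset.Ico (m + 1) (m + 1 + (n + 1))) (fun i hi => by
      rw [Finset.mem_Ico] at hi
      exact (mul_le_mul_of_nonneg_left (hmono hi.1) ht.le).trans hm2)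
    have h6 := Finset.card_nsmul_le_sum (Finset.Ico (m + 1) (m + 1 + (n + 1)))
      (fun i => t * p i / 6) (1 / 18)
      (fun i hi => by
        rw [Finset.mem_Ico] at hi
        have h7 := mul_le_mul_of_nonneg_left (hmono (show i ≤ m + (n + 1) by omega)) ht.le
        have h8 := mul_le_mul_of_nonneg_left h3.le ht.le
        linarith)
    rw [nsmul_eq_mul, Nat.card_Ico] at h6
    have h9 : ((m + 1 + (n + 1) - (m + 1) : ℕ) : ℝ) = n + 1 := by
      rw [Nat.add_sub_cancel_left]; push_cast; ring
    rw [h9] at h6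
    linarith
  · rw [tendsto_atTop]
    intro b
    have hM : 0 < 6 * |b| + 1 := by positivity
    obtain ⟨N, hN⟩ := eventually_atTop.mp
      (h.eventually_le_const (show (0 : ℝ) < 1 / (6 * |b| + 1) by positivity))
    filter_upwards [s11_index p hpos hmono hs N] with t ⟨ht, m, hm, hm1, hm2⟩
    have h3 := hN m hm
    have hsm : Summable fun i => p (m + i) := by
      have := (summable_nat_add_iff m).mpr hs
      simpa [add_comm] using this
    have hR : 0 < ∑' i, p (m + i) := hsm.tsum_pos (fun i => (hpos _).le) 0 (hpos _)
    rw [div_le_div_iff₀ hR hM, one_mul, hsm.tsum_eq_zero_add] at h3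
    have hT : ∑' i, t * p (m + (i + 1)) / 6 ≤ Vpois p t := by
      refine Real.tsum_le_of_sum_range_le
        (fun i => div_nonneg (mul_nonneg ht.le (hpos _).le) (by norm_num)) (fun n => ?_)
      have hk := s11_key p hpos hs t ht (Finset.Ico (m + 1) (m + 1 + n)) (fun i hi => by
        rw [Finset.mem_Ico] at hi
        exact (mul_le_mul_of_nonneg_left (hmono hi.1) ht.le).trans hm2)
      rw [Finset.sum_Ico_eq_sum_range, Nat.add_sub_cancel_left] at hk
      refine le_trans (le_of_eq (Finset.sum_congr rfl fun i _ => ?_)) hk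
      rw [show m + (i + 1) = m + 1 + i by omega]
    rw [tsum_div_const, tsum_mul_left] at hT
    simp only [add_zero] at h3
    have h4 : p m * (6 * |b|) ≤ ∑' i, p (m + (i + 1)) := by linarith
    have h5 := mul_le_mul_of_nonneg_left h4 ht.le
    have h6 : 6 * |b| ≤ t * (p m * (6 * |b|)) := by
      have := mul_le_mul_of_nonneg_right hm1.le (show 0 ≤ 6 * |b| by positivity)
      linarith
    have := le_abs_self b
    linarith
end

section
/- Let 0 < α < 1 and let ℓ be slowly varying at ∞. Then ν̄(x) ~ ℓ(1/x) x^{−α} as x → 0+ if and only if ν_1[0,x] ~ (α/(1−α)) x^{1−α} ℓ(1/x) as x → 0+; and either condition implies that for every integer r ≥ 1, ν_r[0,x] ~ (α/(r−α)) x^{r−α} ℓ(1/x) as x → 0+. -/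
open Filter Topology

/-- Tail counting function `ν̄(x) = #{j : p_j ≥ x}`, as a real number. -/
noncomputable def nubar (p : ℕ → ℝ) (x : ℝ) : ℝ := ({j | x ≤ p j}.ncard : ℝ)

/-- `ν_r[0,x] = ∑_j p_j^r · 1(p_j ≤ x)`. -/
noncomputable def nuR (p : ℕ → ℝ) (r : ℕ) (x : ℝ) : ℝ :=
  ∑' j, if p j ≤ x then p j ^ r else 0

/-- A function `ℓ : (0,∞) → (0,∞)` is slowly varying at `∞` if
`ℓ(cy)/ℓ(y) → 1` as `y → ∞` for every `c > 0`. -/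
def SlowlyVarying (ℓ : ℝ → ℝ) : Prop :=
  ∀ c : ℝ, 0 < c → Tendsto (fun y : ℝ => ℓ (c * y) / ℓ y) atTop (𝓝 1)

namespace S14

open MeasureTheory Set

lemma potter (F : ℝ → ℝ) (Y β : ℝ) (hY : 0 < Y) (hβ : 0 ≤ β)
    (hF0 : ∀ y, 0 < y → 0 ≤ F y)
    (hmono : ∀ y z, 0 < y → y ≤ z → F y ≤ F z)
    (h2 : ∀ y, Y ≤ y → F (2 * y) ≤ 2 ^ β * F y) :
    ∀ y, Y ≤ y → ∀ c, 1 ≤ c → F (c * y) ≤ 2 ^ β * c ^ β * F y := by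
  have key : ∀ k : ℕ, ∀ y, Y ≤ y → ∀ c, 1 ≤ c → c ≤ 2 ^ k →
      F (c * y) ≤ 2 ^ β * c ^ β * F y := by
    intro k
    have small : ∀ y, Y ≤ y → ∀ c, 1 ≤ c → c ≤ 2 → F (c * y) ≤ 2 ^ β * c ^ β * F y := by
      intro y hy c hc1 hc2
      have hy0 : 0 < y := hY.trans_le hy
      have h1 : (1:ℝ) ≤ c ^ β := Real.one_le_rpow hc1 hβ
      have h3 : 0 ≤ F y := hF0 y hy0
      have h4 : (0:ℝ) < 2 ^ β := by positivity
      calc F (c * y) ≤ F (2 * y) := hmono _ _ (by positivity) (by nlinarith)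
        _ ≤ 2 ^ β * F y := h2 y hy
        _ = 2 ^ β * 1 * F y := by ring
        _ ≤ _ := by gcongr
    induction k with
    | zero =>
      intro y hy c hc1 hc2
      exact small y hy c hc1 (by norm_num at hc2; linarith)
    | succ k ih =>
      intro y hy c hc1 hc2
      rcases le_or_gt c 2 with h | h
      · exact small y hy c hc1 h
      have hy0 : 0 < y := hY.trans_le hy
      have := ih (2 * y) (by linarith) (c / 2) (by linarith) (by rw [pow_succ] at hc2; linarith)
      rw [show c / 2 * (2 * y) = c * y by ring, Real.div_rpow (by linarith) (by norm_num)] at this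
      have h4 : (0:ℝ) < 2 ^ β := by positivity
      have h5 : (0:ℝ) < c ^ β := by positivity
      calc F (c * y) ≤ _ := this
        _ ≤ 2 ^ β * (c ^ β / 2 ^ β) * (2 ^ β * F y) := by
          gcongr; exact h2 y hy
        _ = _ := by field_simp
  intro y hy c hc
  obtain ⟨k, hk⟩ := pow_unbounded_of_one_lt c (one_lt_two)
  exact key k y hy c hc hk.le

/-- regular variation of g. -/
lemma g_rv (ℓ : ℝ → ℝ) (hℓ : SlowlyVarying ℓ) (c : ℝ) (hc : 0 < c) (b : ℝ) :
    Tendsto (fun x : ℝ => (ℓ (1 / (c * x)) * (c * x) ^ b) / (ℓ (1 / x) * x ^ b))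
      (𝓝[>] 0) (𝓝 (c ^ b)) := by
  have h := (hℓ c⁻¹ (inv_pos.2 hc)).comp tendsto_inv_nhdsGT_zero
  have h2 := h.mul_const (c ^ b)
  rw [one_mul] at h2
  refine h2.congr' ?_
  filter_upwards [self_mem_nhdsWithin] with x (hx : 0 < x)
  have : x ^ b ≠ 0 := by positivity
  simp only [Function.comp, one_div, mul_inv]
  rw [Real.mul_rpow hc.le hx.le]
  field_simp

lemma scale_tendsto (c : ℝ) (hc : 0 < c) :
    Tendsto (fun x : ℝ => c * x) (𝓝[>] 0) (𝓝[>] 0) := by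
  refine tendsto_nhdsWithin_iff.2 ⟨?_, ?_⟩
  · have : Tendsto (fun x : ℝ => c * x) (𝓝 0) (𝓝 (c * 0)) := by
      exact (continuous_const.mul continuous_id).tendsto 0
    rw [mul_zero] at this
    exact this.mono_left nhdsWithin_le_nhds
  · filter_upwards [self_mem_nhdsWithin] with x (hx : 0 < x)
    exact mul_pos hc hx

lemma scaled (A g : ℝ → ℝ) (L b : ℝ) (hg : ∀ x, 0 < x → 0 < g x)
    (c : ℝ) (hc : 0 < c)
    (hrv : Tendsto (fun x => g (c * x) / g x) (𝓝[>] 0) (𝓝 (c ^ b)))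
    (hA : Tendsto (fun x => A x / g x) (𝓝[>] 0) (𝓝 L)) :
    Tendsto (fun x => A (c * x) / g x) (𝓝[>] 0) (𝓝 (L * c ^ b)) := by
  refine ((hA.comp (scale_tendsto c hc)).mul hrv).congr' ?_
  filter_upwards [self_mem_nhdsWithin] with x (hx : 0 < x)
  have h1 := hg x hx
  have h2 := hg (c * x) (mul_pos hc hx)
  simp only [Function.comp]
  field_simp

lemma sandwich (A B g : ℝ → ℝ) (b : ℝ) (hg : ∀ x, 0 < x → 0 < g x)
    (hrv : ∀ c, 0 < c → Tendsto (fun x => g (c * x) / g x) (𝓝[>] 0) (𝓝 (c ^ b)))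
    (hA : Tendsto (fun x => A x / g x) (𝓝[>] 0) (𝓝 1))
    (h1 : ∀ c x, 1 < c → 0 < x → A (c * x) ≤ B x)
    (h2 : ∀ c x, 1 < c → 0 < x → B x ≤ A (c⁻¹ * x)) :
    Tendsto (fun x => B x / g x) (𝓝[>] 0) (𝓝 1) := by
  have cont1 : Tendsto (fun c : ℝ => c ^ b) (𝓝[>] 1) (𝓝 1) := by
    have := (Real.continuousAt_rpow_const 1 b (Or.inl one_ne_zero)).tendsto
    rw [Real.one_rpow] at this
    exact this.mono_left nhdsWithin_le_nhds
  have cont2 : Tendsto (fun c : ℝ => c⁻¹ ^ b) (𝓝[>] 1) (𝓝 1) := by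
    have := cont1.inv₀ one_ne_zero
    rw [inv_one] at this
    refine this.congr' ?_
    filter_upwards [self_mem_nhdsWithin] with c (hc : 1 < c)
    rw [Real.inv_rpow (by linarith)]
  rw [tendsto_order]
  constructor
  · intro a ha
    obtain ⟨c, hc, hc1⟩ := ((cont1.eventually (lt_mem_nhds ha)).and self_mem_nhdsWithin).exists
    have hc1 : 1 < c := hc1
    have := scaled A g 1 b hg c (by linarith) (hrv c (by linarith)) hA
    rw [one_mul] at this
    filter_upwards [this.eventually (lt_mem_nhds hc), self_mem_nhdsWithin] with x hx (hx0 : 0 < x)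
    refine hx.trans_le ?_
    have := hg x hx0
    gcongr
    exact h1 c x hc1 hx0
  · intro a ha
    obtain ⟨c, hc, hc1⟩ := ((cont2.eventually (gt_mem_nhds ha)).and self_mem_nhdsWithin).exists
    have hc1 : 1 < c := hc1
    have hc0 : 0 < c⁻¹ := inv_pos.2 (by linarith)
    have := scaled A g 1 b hg c⁻¹ hc0 (hrv _ hc0) hA
    rw [one_mul] at this
    filter_upwards [this.eventually (gt_mem_nhds hc), self_mem_nhdsWithin] with x hx (hx0 : 0 < x)
    refine lt_of_le_of_lt ?_ hx
    have := hg x hx0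
    gcongr
    exact h2 c x hc1 hx0

/-- strict counting function -/
noncomputable def nus (p : ℕ → ℝ) (x : ℝ) : ℝ := ({j | x < p j}.ncard : ℝ)

lemma fin (p : ℕ → ℝ) (hs : Summable p) (x : ℝ) (hx : 0 < x) : {j | x ≤ p j}.Finite := by
  have h := hs.tendsto_cofinite_zero.eventually (gt_mem_nhds hx)
  rw [Filter.eventually_cofinite] at h
  simpa using h

lemma nus_le (p : ℕ → ℝ) (hs : Summable p) (x : ℝ) (hx : 0 < x) : nus p x ≤ nubar p x := by
  unfold nus nubar
  exact_mod_cast Set.ncard_le_ncard (fun j (hj : x < p j) => hj.le) (fin p hs x hx)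

lemma nubar_le_nus (p : ℕ → ℝ) (hs : Summable p) (x y : ℝ) (hx : 0 < x) (hxy : x < y) :
    nubar p y ≤ nus p x := by
  unfold nus nubar
  exact_mod_cast Set.ncard_le_ncard (fun j (hj : y ≤ p j) => (hxy.trans_le hj : x < p j))
    ((fin p hs x hx).subset (fun j (hj : x < p j) => hj.le))

lemma nubar_anti (p : ℕ → ℝ) (hs : Summable p) (x y : ℝ) (hx : 0 < x) (hxy : x ≤ y) :
    nubar p y ≤ nubar p x := by
  unfold nubar
  exact_mod_cast Set.ncard_le_ncard (fun j (hj : y ≤ p j) => (hxy.trans hj : x ≤ p j))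
    (fin p hs x hx)

lemma hasSum_count (s : Set ℕ) (hs : s.Finite) (a : ℝ) [DecidablePred (· ∈ s)] :
    HasSum (fun j => if j ∈ s then a else 0) (a * (s.ncard : ℝ)) := by
  have := hasSum_sum_of_ne_finset_zero (L := SummationFilter.unconditional ℕ) (f := fun j => if j ∈ s then a else 0) (s := hs.toFinset)
    (by intro b hb; simp at hb; simp [hb])
  convert this using 1
  rw [Finset.sum_congr rfl (g := fun _ => a) (by intro j hj; simp at hj; simp [hj])]
  rw [Set.ncard_eq_toFinset_card s hs]
  simp [mul_comm]

lemma summable_nuR (p : ℕ → ℝ) (hpos : ∀ j, 0 < p j) (hs : Summable p) (n : ℕ) (x : ℝ) :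
    Summable (fun j => if p j ≤ x then p j ^ (n+1) else 0) := by
  refine Summable.of_nonneg_of_le (f := fun j => x ^ n * p j ⊔ 0) ?_ ?_ ?_
  · intro j; have := hpos j; split_ifs <;> positivity
  · intro j
    have := hpos j
    split_ifs with h
    · refine le_max_of_le_left ?_
      rw [pow_succ]; gcongr
    · exact le_max_right _ _
  · rcases le_or_gt 0 x with h | h
    · refine (hs.mul_left (x ^ n)).congr fun j => ?_
      rw [max_eq_left]
      have := hpos j; positivity
    · rcases le_or_gt 0 (x ^ n) with h' | h'
      · refine (hs.mul_left (x ^ n)).congr fun j => ?_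
        rw [max_eq_left]
        have := hpos j; positivity
      · refine summable_zero.congr fun j => ?_
        rw [max_eq_right]
        exact mul_nonpos_of_nonpos_of_nonneg h'.le (hpos j).le

lemma hasSum_min (p : ℕ → ℝ) (hpos : ∀ j, 0 < p j) (hs : Summable p) (n : ℕ) (x : ℝ)
    (hx : 0 < x) :
    HasSum (fun j => (min 1 (p j / x)) ^ (n+1)) (nuR p (n+1) x / x ^ (n+1) + nus p x) := by
  classical
  have h1 := ((summable_nuR p hpos hs n x).hasSum).div_const (x ^ (n+1))
  have h2 := hasSum_count {j | x < p j} ((fin p hs x hx).subset (fun j (hj : x < p j) => hj.le)) 1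
  rw [one_mul] at h2
  have e : (fun j => (min 1 (p j / x)) ^ (n+1)) = fun j =>
      (if p j ≤ x then p j ^ (n+1) else 0) / x ^ (n+1) + (if j ∈ {j | x < p j} then (1:ℝ) else 0) := by
    ext j
    by_cases h : p j ≤ x
    · have h' : p j / x ≤ 1 := (div_le_one hx).2 h
      simp [h, h', not_lt.2 h, div_pow]
    · push Not at h
      have h' : 1 ≤ p j / x := (one_le_div hx).2 h.le
      simp [h, h', not_le.2 h]
  rw [e]
  exact h1.add h2

lemma int_A (n : ℕ) (a : ℝ) (ha : 0 < a) :
    IntegrableOn (fun u : ℝ => if u ≤ a then ((n:ℝ)+1) * u ^ n else 0) (Ioc 0 1) ∧ 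
    ∫ u in Ioc (0:ℝ) 1, (if u ≤ a then ((n:ℝ)+1) * u ^ n else 0) = (min 1 a) ^ (n+1) := by
  have e : (fun u : ℝ => if u ≤ a then ((n:ℝ)+1) * u ^ n else 0) =
      (Iic a).indicator (fun u => ((n:ℝ)+1) * u ^ n) := by
    ext u; simp [indicator]
  rw [e]
  constructor
  · refine Integrable.indicator ?_ measurableSet_Iic
    refine IntegrableOn.mono_set ?_ Ioc_subset_Icc_self
    exact (by fun_prop : Continuous fun u : ℝ => ((n:ℝ)+1) * u ^ n).integrableOn_Icc
  · rw [setIntegral_indicator measurableSet_Iic, Ioc_inter_Iic,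
      ← intervalIntegral.integral_of_le (by positivity), intervalIntegral.integral_const_mul,
      integral_pow]
    have : (n:ℝ) + 1 ≠ 0 := by positivity
    field_simp
    simp

lemma int_B (a : ℝ) (ha : 0 < a) :
    IntegrableOn (fun u : ℝ => if a ≤ u then a * u ^ (-2:ℝ) else 0) (Ioi 1) ∧ 
    ∫ u in Ioi (1:ℝ), (if a ≤ u then a * u ^ (-2:ℝ) else 0) = (min 1 a) := by
  have e : (fun u : ℝ => if a ≤ u then a * u ^ (-2:ℝ) else 0) =
      (Ici a).indicator (fun u => a * u ^ (-2:ℝ)) := by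
    ext u; simp [indicator]
  rw [e]
  constructor
  · refine Integrable.indicator ?_ measurableSet_Ici
    exact (integrableOn_Ioi_rpow_of_lt (by norm_num) one_pos).const_mul a
  · have h0 : (Ici a).indicator (fun u : ℝ => a * u ^ (-2:ℝ)) =ᵐ[volume.restrict (Ioi 1)]
        (Ioi a).indicator (fun u : ℝ => a * u ^ (-2:ℝ)) :=
      ae_restrict_of_ae (indicator_ae_eq_of_ae_eq_set Ioi_ae_eq_Ici.symm)
    rw [integral_congr_ae h0, setIntegral_indicator measurableSet_Ioi, Ioi_inter_Ioi, 
      integral_const_mul, integral_Ioi_rpow_of_lt (by norm_num) (by positivity)]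
    norm_num
    rw [Real.rpow_neg_one]
    rcases le_total 1 a with h | h
    · simp [h]; field_simp
    · simp [h]

lemma layerA (p : ℕ → ℝ) (hpos : ∀ j, 0 < p j) (hs : Summable p) (n : ℕ) (x : ℝ)
    (hx : 0 < x) :
    ∫ u in Ioc (0:ℝ) 1, ((n:ℝ)+1) * u ^ n * nubar p (x * u) =
      nuR p (n+1) x / x ^ (n+1) + nus p x := by
  classical
  have hm := hasSum_min p hpos hs n x hx
  have hp : ∀ j, 0 < p j / x := fun j => div_pos (hpos j) hx
  have key := hasSum_integral_of_summable_integral_norm (μ := volume.restrict (Ioc (0:ℝ) 1))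
    (F := fun j u => if u ≤ p j / x then ((n:ℝ)+1) * u ^ n else 0)
    (fun j => (int_A n _ (hp j)).1) (by
      refine hm.summable.congr fun j => ?_
      rw [← (int_A n _ (hp j)).2]
      refine setIntegral_congr_fun measurableSet_Ioc fun u hu => ?_
      have : 0 < u := hu.1
      rw [Real.norm_of_nonneg]
      split_ifs <;> positivity)
  simp only [fun j => (int_A n _ (hp j)).2] at key
  rw [hm.unique key]
  refine setIntegral_congr_fun measurableSet_Ioc fun u hu => ?_
  have hu0 : 0 < u := hu.1
  have h2 := hasSum_count {j | x * u ≤ p j} (fin p hs (x*u) (by positivity)) (((n:ℝ)+1) * u ^ n)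
  unfold nubar
  rw [← h2.tsum_eq]
  refine tsum_congr fun j => ?_
  simp only [Set.mem_setOf_eq, le_div_iff₀ hx, mul_comm x u]

lemma layerB (p : ℕ → ℝ) (hpos : ∀ j, 0 < p j) (hs : Summable p) (x : ℝ)
    (hx : 0 < x) :
    ∫ u in Ioi (1:ℝ), u ^ (-2:ℝ) * (nuR p 1 (x * u) / x) =
      nuR p 1 x / x + nus p x := by
  classical
  have hm := hasSum_min p hpos hs 0 x hx
  simp only [zero_add, pow_one] at hm
  have hp : ∀ j, 0 < p j / x := fun j => div_pos (hpos j) hx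
  have key := hasSum_integral_of_summable_integral_norm (μ := volume.restrict (Ioi (1:ℝ)))
    (F := fun j u => if p j / x ≤ u then (p j / x) * u ^ (-2:ℝ) else 0)
    (fun j => (int_B _ (hp j)).1) (by
      refine hm.summable.congr fun j => ?_
      rw [← (int_B _ (hp j)).2]
      refine setIntegral_congr_fun measurableSet_Ioi fun u hu => ?_
      have : 0 < u := zero_lt_one.trans hu
      have := hp j
      rw [Real.norm_of_nonneg]
      split_ifs <;> positivity)
  simp only [fun j => (int_B _ (hp j)).2] at key
  rw [hm.unique key]
  refine setIntegral_congr_fun measurableSet_Ioi fun u hu => ?_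
  have hu0 : 0 < u := zero_lt_one.trans hu
  unfold nuR
  rw [← tsum_div_const, ← tsum_mul_left]
  refine tsum_congr fun j => ?_
  simp only [div_le_iff₀ hx, mul_comm x u, pow_one]
  split_ifs
  · ring
  · simp

lemma nuR_mono (p : ℕ → ℝ) (hpos : ∀ j, 0 < p j) (hs : Summable p) :
    Monotone (nuR p 1) := by
  intro x y hxy
  refine (summable_nuR p hpos hs 0 x).tsum_le_tsum ?_ (summable_nuR p hpos hs 0 y)
  intro j
  have := hpos j
  split_ifs with h1 h2
  · exact le_rfl
  · exact absurd (h1.trans hxy) h2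
  · positivity
  · exact le_rfl

lemma nuR_pos (p : ℕ → ℝ) (hpos : ∀ j, 0 < p j) (hs : Summable p) (x : ℝ) (hx : 0 < x) :
    0 < nuR p 1 x := by
  obtain ⟨j, hj⟩ := (hs.tendsto_atTop_zero.eventually (gt_mem_nhds hx)).exists
  refine (summable_nuR p hpos hs 0 x).tsum_pos ?_ j ?_
  · intro i; have := hpos i; split_ifs <;> positivity
  · rw [if_pos hj.le]; have := hpos j; positivity

lemma nuR_le (p : ℕ → ℝ) (hpos : ∀ j, 0 < p j) (hs : Summable p) (hsum : ∑' j, p j = 1) (x : ℝ) :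
    nuR p 1 x ≤ 1 := by
  rw [← hsum]
  refine (summable_nuR p hpos hs 0 x).tsum_le_tsum ?_ hs
  intro j
  have := hpos j
  split_ifs
  · simp
  · exact this.le

/-- Potter bound near zero for monotone-in-`1/x` functions. -/
lemma potterA (A g : ℝ → ℝ) (b β : ℝ) (hβ : 0 ≤ β) (hb : -b < β)
    (hg : ∀ x, 0 < x → 0 < g x)
    (hrv : ∀ c, 0 < c → Tendsto (fun x => g (c * x) / g x) (𝓝[>] 0) (𝓝 (c ^ b)))
    (L : ℝ) (hL : 0 < L)
    (hA : Tendsto (fun x => A x / g x) (𝓝[>] 0) (𝓝 L))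
    (hA0 : ∀ x, 0 < x → 0 ≤ A x)
    (hanti : ∀ x y, 0 < x → x ≤ y → A y ≤ A x) :
    ∃ x0, 0 < x0 ∧ ∀ x, 0 < x → x ≤ x0 → ∀ u, 0 < u → u ≤ 1 →
      A (x * u) ≤ 2 ^ β * u ^ (-β) * A x := by
  have h1 := scaled A g L b hg (2⁻¹) (by norm_num) (hrv _ (by norm_num)) hA
  have h2 := h1.div hA hL.ne'
  have h3 : L * (2⁻¹ : ℝ) ^ b / L < 2 ^ β := by
    rw [mul_div_cancel_left₀ _ hL.ne', Real.inv_rpow (by norm_num), ← Real.rpow_neg (by norm_num)]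
    exact Real.rpow_lt_rpow_of_exponent_lt (by norm_num) hb
  have h4 := (h2.eventually (gt_mem_nhds h3)).and (hA.eventually (lt_mem_nhds hL))
  rw [eventually_nhdsWithin_iff, Metric.eventually_nhds_iff] at h4
  obtain ⟨ε, hε, h4⟩ := h4
  have h5 : ∀ x, 0 < x → x < ε → A (2⁻¹ * x) ≤ 2 ^ β * A x := by
    intro x hx hxε
    obtain ⟨h6, h7⟩ := h4 (y := x) (by simpa [abs_of_pos hx] using hxε) hx
    have hgx := hg x hx
    have hAx : 0 < A x := by
      have := mul_pos h7 hgx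
      rwa [div_mul_cancel₀ _ hgx.ne'] at this
    simp only [Pi.div_apply] at h6
    rw [div_div_div_cancel_right₀ hgx.ne', div_lt_iff₀ hAx] at h6
    exact h6.le
  refine ⟨ε / 2, by positivity, ?_⟩
  intro x hx hxε u hu hu1
  have := potter (fun y => A (1 / y)) (1 / (ε / 2)) β (by positivity) hβ
    (fun y hy => hA0 _ (by positivity))
    (fun y z hy hyz => hanti _ _ (by have := hy.trans_le hyz; positivity)
      (one_div_le_one_div_of_le hy hyz))
    (fun y hy => by
      have hy0 : 0 < y := lt_of_lt_of_le (by positivity) hy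
      have := h5 (1 / y) (by positivity) (by
        have : 1 / y ≤ ε / 2 := (one_div_le hy0 (by positivity)).2 hy
        linarith)
      rwa [show (2:ℝ)⁻¹ * (1 / y) = 1 / (2 * y) by field_simp] at this)
    (1 / x) (one_div_le_one_div_of_le hx hxε) (1 / u) (by rw [le_div_iff₀ hu]; linarith)
  rw [show 1 / (1 / u * (1 / x)) = x * u by field_simp, one_div_one_div, one_div,
    Real.inv_rpow hu.le, ← Real.rpow_neg hu.le] at this
  exact this

lemma dctA (p : ℕ → ℝ) (hs : Summable p) (n : ℕ) (g : ℝ → ℝ)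
    (α : ℝ) (hα0 : 0 < α) (hα1 : α < 1)
    (hg : ∀ x, 0 < x → 0 < g x)
    (hrv : ∀ c, 0 < c → Tendsto (fun x => g (c * x) / g x) (𝓝[>] 0) (𝓝 (c ^ (-α))))
    (hA : Tendsto (fun x => nubar p x / g x) (𝓝[>] 0) (𝓝 1)) :
    Tendsto (fun x => ∫ u in Ioc (0:ℝ) 1, ((n:ℝ)+1) * u ^ n * (nubar p (x * u) / g x))
      (𝓝[>] 0) (𝓝 (((n:ℝ)+1) / ((n:ℝ) + 1 - α))) := by
  have hn : (0:ℝ) ≤ n := n.cast_nonneg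
  obtain ⟨x0, hx0, hP⟩ := potterA (nubar p) g (-α) ((1 + α) / 2) (by linarith) (by linarith)
    hg hrv 1 one_pos hA (fun x _ => Nat.cast_nonneg _) (nubar_anti p hs)
  have hval : ∫ u in Ioc (0:ℝ) 1, ((n:ℝ)+1) * u ^ n * (u ^ (-α)) = 
      ((n:ℝ)+1) / ((n:ℝ) + 1 - α) := by
    have : ∫ u in Ioc (0:ℝ) 1, ((n:ℝ)+1) * u ^ n * (u ^ (-α)) =
        ∫ u in Ioc (0:ℝ) 1, ((n:ℝ)+1) * u ^ ((n:ℝ) - α) := by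
      refine setIntegral_congr_fun measurableSet_Ioc fun u hu => ?_
      have hu0 : 0 < u := hu.1
      rw [sub_eq_add_neg, Real.rpow_add hu0, Real.rpow_natCast]; ring
    rw [this, ← intervalIntegral.integral_of_le zero_le_one, intervalIntegral.integral_const_mul,
      integral_rpow (Or.inl (by linarith)), Real.one_rpow, Real.zero_rpow (by linarith)]
    rw [sub_zero, show (n:ℝ) - α + 1 = n + 1 - α by ring]; ring
  rw [← hval]
  refine tendsto_integral_filter_of_dominated_convergence
    (fun u => ((n:ℝ)+1) * 1 * (2 ^ ((1 + α) / 2) * u ^ (-((1 + α) / 2)) * 2)) ?_ ?_ ?_ ?_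
  · filter_upwards [self_mem_nhdsWithin] with x (hx : 0 < x)
    have hanti : AntitoneOn (fun u => nubar p (x * u)) (Ioc 0 1) := by
      intro u hu v hv huv
      exact nubar_anti p hs _ _ (mul_pos hx hu.1) (by gcongr)
    have := (aemeasurable_restrict_of_antitoneOn (μ := volume) measurableSet_Ioc hanti)
    have h2 : Measurable (fun u : ℝ => ((n:ℝ)+1) * u ^ n) := by fun_prop
    exact (h2.aemeasurable.mul (this.div_const _)).aestronglyMeasurable
  · have hle : ∀ᶠ x : ℝ in 𝓝[>] 0, x ≤ x0 :=
      nhdsWithin_le_nhds (Iic_mem_nhds hx0)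
    filter_upwards [self_mem_nhdsWithin, hle, hA.eventually (gt_mem_nhds one_lt_two)]
      with x (hx : 0 < x) hxx0 h2
    refine (ae_restrict_iff' measurableSet_Ioc).2 (Eventually.of_forall fun u hu => ?_)
    have hu0 : 0 < u := hu.1
    have hgx := hg x hx
    have h0 : 0 ≤ nubar p (x * u) := Nat.cast_nonneg _
    rw [Real.norm_of_nonneg (by positivity)]
    have := hP x hx hxx0 u hu0 hu.2
    gcongr
    · exact pow_le_one₀ hu0.le hu.2
    · calc nubar p (x * u) / g x ≤ (2 ^ ((1 + α) / 2) * u ^ (-((1 + α) / 2)) * nubar p x) / g x := by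
            gcongr
        _ = 2 ^ ((1 + α) / 2) * u ^ (-((1 + α) / 2)) * (nubar p x / g x) := by ring
        _ ≤ _ := by gcongr
  · have : IntegrableOn (fun u : ℝ => u ^ (-((1 + α) / 2))) (Ioc 0 1) := by
      rw [← intervalIntegrable_iff_integrableOn_Ioc_of_le zero_le_one]
      exact intervalIntegral.intervalIntegrable_rpow' (by linarith)
    exact ((this.const_mul _).mul_const _).const_mul _
  · refine (ae_restrict_iff' measurableSet_Ioc).2 (Eventually.of_forall fun u hu => ?_)
    have := scaled (nubar p) g 1 (-α) hg u hu.1 (hrv u hu.1) hA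
    rw [one_mul] at this
    simp only [mul_comm u] at this
    exact this.const_mul _

lemma dctB (p : ℕ → ℝ) (hpos : ∀ j, 0 < p j) (hs : Summable p) (hsum : ∑' j, p j = 1)
    (g : ℝ → ℝ)
    (α : ℝ) (hα0 : 0 < α) (hα1 : α < 1)
    (hg : ∀ x, 0 < x → 0 < g x)
    (hrv : ∀ c, 0 < c → Tendsto (fun x => g (c * x) / g x) (𝓝[>] 0) (𝓝 (c ^ (1-α))))
    (hA : Tendsto (fun x => nuR p 1 x / g x) (𝓝[>] 0) (𝓝 1)) :
    Tendsto (fun x => ∫ u in Ioi (1:ℝ), u ^ (-2:ℝ) * (nuR p 1 (x * u) / g x))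
      (𝓝[>] 0) (𝓝 (1 / α)) := by
  have hMpos := nuR_pos p hpos hs
  obtain ⟨x0, hx0, hP⟩ := potterA (fun x => (nuR p 1 x)⁻¹) (fun x => (g x)⁻¹)
    (-(1-α)) (1 - α / 2) (by linarith) (by linarith)
    (fun x hx => inv_pos.2 (hg x hx)) (fun c hc => by
      have := (hrv c hc).inv₀ (by positivity)
      rw [← Real.rpow_neg hc.le] at this
      refine this.congr fun x => ?_
      rw [inv_div_inv, inv_div]) 1 one_pos (by
      have := hA.inv₀ one_ne_zero
      rw [inv_one] at this
      refine this.congr fun x => ?_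
      rw [inv_div_inv, inv_div]) (fun x hx => (inv_pos.2 (hMpos x hx)).le)
      (fun x y hx hxy => inv_anti₀ (hMpos x hx) (nuR_mono p hpos hs hxy))
  set β := 1 - α / 2 with hβ
  have hB1 : ∀ x u, 0 < x → 1 ≤ u → x * u ≤ x0 → nuR p 1 (x * u) ≤ 2 ^ β * u ^ β * nuR p 1 x := by
    intro x u hx hu hxu
    have hu0 : 0 < u := by linarith
    have h1 := hP (x * u) (by positivity) hxu (u⁻¹) (by positivity) (inv_le_one_of_one_le₀ hu)
    rw [mul_assoc, mul_inv_cancel₀ hu0.ne', mul_one, Real.inv_rpow hu0.le,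
      Real.rpow_neg hu0.le, inv_inv] at h1
    have a1 := hMpos x hx
    have a2 := hMpos (x * u) (by positivity)
    rw [← div_eq_mul_inv, inv_eq_one_div, div_le_div_iff₀ a1 a2] at h1
    linarith
  have hM0 := hMpos x0 hx0
  set C := 2 ^ β / nuR p 1 x0 with hC
  have hM01 := nuR_le p hpos hs hsum x0
  have hCge : 2 ^ β ≤ C := by
    rw [hC, le_div_iff₀ hM0]
    have : (0:ℝ) < 2 ^ β := by positivity
    nlinarith
  have hB : ∀ x u, 0 < x → x ≤ x0 → 1 ≤ u → nuR p 1 (x * u) ≤ C * u ^ β * nuR p 1 x := by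
    intro x u hx hxx0 hu
    have a1 := hMpos x hx
    have hu0 : 0 < u := by linarith
    rcases le_or_gt (x * u) x0 with h | h
    · refine (hB1 x u hx hu h).trans ?_
      gcongr
    · have h2 := hB1 x (x0 / x) hx ((one_le_div hx).2 hxx0) (by field_simp; exact le_rfl)
      rw [mul_div_cancel₀ _ hx.ne'] at h2
      have h3 : x0 / x ≤ u := by rw [div_le_iff₀ hx]; linarith
      calc nuR p 1 (x * u) ≤ 1 := nuR_le p hpos hs hsum _
        _ = nuR p 1 x0 / nuR p 1 x0 := (div_self hM0.ne').symm
        _ ≤ (2 ^ β * (x0 / x) ^ β * nuR p 1 x) / nuR p 1 x0 := by gcongr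
        _ ≤ (2 ^ β * u ^ β * nuR p 1 x) / nuR p 1 x0 := by
          gcongr
          linarith
        _ = _ := by rw [hC]; ring
  have hval : ∫ u in Ioi (1:ℝ), u ^ (-2:ℝ) * (u ^ (1-α)) = 1 / α := by
    have : ∫ u in Ioi (1:ℝ), u ^ (-2:ℝ) * (u ^ (1-α)) =
        ∫ u in Ioi (1:ℝ), u ^ (-1-α) := by
      refine setIntegral_congr_fun measurableSet_Ioi fun u hu => ?_
      have hu0 : 0 < u := zero_lt_one.trans hu
      rw [← Real.rpow_add hu0]; congr 1; ring
    rw [this, integral_Ioi_rpow_of_lt (by linarith) one_pos, Real.one_rpow,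
      show -1 - α + 1 = -α by ring, neg_div_neg_eq]
  rw [← hval]
  refine tendsto_integral_filter_of_dominated_convergence
    (fun u => u ^ (-2:ℝ) * (C * u ^ β * 2)) ?_ ?_ ?_ ?_
  · filter_upwards [self_mem_nhdsWithin] with x (hx : 0 < x)
    have hm : Measurable (nuR p 1) := (nuR_mono p hpos hs).measurable
    have : Measurable (fun u : ℝ => u ^ (-2:ℝ) * (nuR p 1 (x * u) / g x)) := by fun_prop
    exact this.aestronglyMeasurable
  · have hle : ∀ᶠ x : ℝ in 𝓝[>] 0, x ≤ x0 :=
      nhdsWithin_le_nhds (Iic_mem_nhds hx0)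
    filter_upwards [self_mem_nhdsWithin, hle, hA.eventually (gt_mem_nhds one_lt_two)]
      with x (hx : 0 < x) hxx0 h2
    refine (ae_restrict_iff' measurableSet_Ioi).2 (Eventually.of_forall fun u hu => ?_)
    have hu1 : 1 < u := hu
    have hu0 : 0 < u := by linarith
    have hgx := hg x hx
    have h0 := hMpos (x * u) (by positivity)
    rw [Real.norm_of_nonneg (by positivity)]
    have := hB x u hx hxx0 hu1.le
    gcongr
    calc nuR p 1 (x * u) / g x ≤ (C * u ^ β * nuR p 1 x) / g x := by
            gcongr
        _ = C * u ^ β * (nuR p 1 x / g x) := by ring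
        _ ≤ _ := by gcongr
  · have : IntegrableOn (fun u : ℝ => u ^ (-2 + β)) (Ioi 1) :=
      integrableOn_Ioi_rpow_of_lt (by linarith) one_pos
    refine IntegrableOn.congr_fun (this.const_mul (C * 2)) ?_ measurableSet_Ioi
    intro u hu
    have hu0 : 0 < u := zero_lt_one.trans hu
    simp only
    rw [Real.rpow_add hu0]; ring
  · refine (ae_restrict_iff' measurableSet_Ioi).2 (Eventually.of_forall fun u hu => ?_)
    have hu0 : 0 < u := zero_lt_one.trans hu
    have := scaled (nuR p 1) g 1 (1-α) hg u hu0 (hrv u hu0) hA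
    rw [one_mul] at this
    simp only [mul_comm u] at this
    exact this.const_mul _

lemma fwd (p : ℕ → ℝ) (hpos : ∀ j, 0 < p j) (hs : Summable p)
    (α : ℝ) (hα0 : 0 < α) (hα1 : α < 1)
    (ℓ : ℝ → ℝ) (hℓpos : ∀ y : ℝ, 0 < y → 0 < ℓ y) (hℓ : SlowlyVarying ℓ)
    (hA : Tendsto (fun x : ℝ => nubar p x / (ℓ (1 / x) * x ^ (-α))) (𝓝[>] 0) (𝓝 1)) (n : ℕ) :
    Tendsto (fun x : ℝ => nuR p (n+1) x /
      (α / (((n:ℝ)+1) - α) * x ^ (((n:ℝ)+1) - α) * ℓ (1 / x))) (𝓝[>] 0) (𝓝 1) := by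
  have hn : (0:ℝ) ≤ n := n.cast_nonneg
  have hg : ∀ x : ℝ, 0 < x → 0 < ℓ (1 / x) * x ^ (-α) := fun x hx => by
    have := hℓpos (1 / x) (by positivity)
    positivity
  have hrv := fun c hc => g_rv ℓ hℓ c hc (-α)
  have h1 := dctA p hs n (fun x => ℓ (1 / x) * x ^ (-α)) α hα0 hα1 hg hrv hA
  have h2 := sandwich (nubar p) (nus p) (fun x => ℓ (1 / x) * x ^ (-α)) (-α) hg hrv hA
    (fun c x hc hx => nubar_le_nus p hs _ _ hx (by nlinarith))
    (fun c x hc hx => (nus_le p hs x hx).trans (nubar_anti p hs _ _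
      (mul_pos (inv_pos.2 (by linarith)) hx)
      (mul_le_of_le_one_left hx.le (inv_le_one_of_one_le₀ hc.le))))
  have h3 := (h1.sub h2).div_const (α / ((n:ℝ) + 1 - α))
  have hd : (n:ℝ) + 1 - α ≠ 0 := by linarith
  have e : (((n:ℝ)+1) / ((n:ℝ) + 1 - α) - 1) / (α / ((n:ℝ) + 1 - α)) = 1 := by
    field_simp; ring
  rw [e] at h3
  refine h3.congr' ?_
  filter_upwards [self_mem_nhdsWithin] with x (hx : 0 < x)
  have hl := hℓpos (1 / x) (by positivity)
  have := layerA p hpos hs n x hx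
  simp only [← mul_div_assoc]
  rw [integral_div, this]
  have e2 : x ^ ((n:ℝ) + 1 - α) = x ^ (n+1) * x ^ (-α) := by
    rw [sub_eq_add_neg, Real.rpow_add hx, ← Real.rpow_natCast]; push_cast; rfl
  rw [e2]
  have : 0 < x ^ (-α) := by positivity
  field_simp
  ring

lemma bwd (p : ℕ → ℝ) (hpos : ∀ j, 0 < p j) (hs : Summable p) (hsum : ∑' j, p j = 1)
    (α : ℝ) (hα0 : 0 < α) (hα1 : α < 1)
    (ℓ : ℝ → ℝ) (hℓpos : ∀ y : ℝ, 0 < y → 0 < ℓ y) (hℓ : SlowlyVarying ℓ)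
    (hA : Tendsto (fun x : ℝ => nuR p 1 x / (α / (1 - α) * x ^ (1 - α) * ℓ (1 / x)))
        (𝓝[>] 0) (𝓝 1)) :
    Tendsto (fun x : ℝ => nubar p x / (ℓ (1 / x) * x ^ (-α))) (𝓝[>] 0) (𝓝 1) := by
  have ha : 0 < 1 - α := by linarith
  have hg : ∀ x : ℝ, 0 < x → 0 < ℓ (1 / x) * x ^ (-α) := fun x hx => by
    have := hℓpos (1 / x) (by positivity)
    positivity
  have hrv := fun c hc => g_rv ℓ hℓ c hc (-α)
  have hG : ∀ x : ℝ, 0 < x → 0 < α / (1 - α) * x ^ (1 - α) * ℓ (1 / x) := fun x hx => by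
    have := hℓpos (1 / x) (by positivity)
    positivity
  have h1 := dctB p hpos hs hsum (fun x => α / (1 - α) * x ^ (1 - α) * ℓ (1 / x))
    α hα0 hα1 hG (fun c hc => by
      refine (g_rv ℓ hℓ c hc (1-α)).congr fun x => ?_
      rw [mul_assoc, mul_assoc, mul_div_mul_left _ _ (by positivity), mul_comm (ℓ _),
        mul_comm (ℓ _)]) hA
  have h3 := (h1.sub hA).mul_const (α / (1 - α))
  have e : (1 / α - 1) * (α / (1 - α)) = 1 := by
    field_simp
  rw [e] at h3
  have h4 : Tendsto (fun x : ℝ => nus p x / (ℓ (1 / x) * x ^ (-α))) (𝓝[>] 0) (𝓝 1) := by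
    refine h3.congr' ?_
    filter_upwards [self_mem_nhdsWithin] with x (hx : 0 < x)
    have hl := hℓpos (1 / x) (by positivity)
    have := layerB p hpos hs x hx
    simp only [← mul_div_assoc] at this ⊢
    rw [integral_div, div_eq_iff hx.ne'] at this
    rw [integral_div, this]
    have e2 : x ^ (1 - α) = x * x ^ (-α) := by
      rw [sub_eq_add_neg, Real.rpow_add hx, Real.rpow_one]
    rw [e2]
    have : 0 < x ^ (-α) := by positivity
    field_simp
    ring
  have cpos : ∀ c : ℝ, 1 < c → c⁻¹ < 1 := fun c hc => inv_lt_one_of_one_lt₀ hc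
  refine sandwich (nus p) (nubar p) (fun x => ℓ (1 / x) * x ^ (-α)) (-α) hg hrv h4
    (fun c x hc hx => (nus_le p hs _ (by positivity)).trans
      (nubar_anti p hs _ _ hx (by nlinarith)))
    (fun c x hc hx => nubar_le_nus p hs _ _ (mul_pos (inv_pos.2 (by linarith)) hx)
      (mul_lt_of_lt_one_left hx (cpos c hc)))

end S14

/-- For `0 < α < 1`: `ν̄(x) ∼ ℓ(1/x) x^{-α}` (x → 0+) iff
`ν_1[0,x] ∼ (α/(1−α)) x^{1−α} ℓ(1/x)`, and either implies
`ν_r[0,x] ∼ (α/(r−α)) x^{r−α} ℓ(1/x)` for every `r ≥ 1`. -/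
theorem stmt_14 (p : ℕ → ℝ) (hpos : ∀ j, 0 < p j) (hmono : Antitone p)
    (hsum : ∑' j, p j = 1)
    (α : ℝ) (hα0 : 0 < α) (hα1 : α < 1)
    (ℓ : ℝ → ℝ) (hℓpos : ∀ y : ℝ, 0 < y → 0 < ℓ y) (hℓ : SlowlyVarying ℓ) :
    (Tendsto (fun x : ℝ => nubar p x / (ℓ (1 / x) * x ^ (-α))) (𝓝[>] 0) (𝓝 1) ↔
      Tendsto (fun x : ℝ => nuR p 1 x / (α / (1 - α) * x ^ (1 - α) * ℓ (1 / x)))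
        (𝓝[>] 0) (𝓝 1)) ∧
    (Tendsto (fun x : ℝ => nubar p x / (ℓ (1 / x) * x ^ (-α))) (𝓝[>] 0) (𝓝 1) →
      ∀ r : ℕ, 1 ≤ r →
        Tendsto
          (fun x : ℝ => nuR p r x / (α / ((r : ℝ) - α) * x ^ ((r : ℝ) - α) * ℓ (1 / x)))
          (𝓝[>] 0) (𝓝 1)) := by
  have hs : Summable p := by
    by_contra h
    rw [tsum_eq_zero_of_not_summable h] at hsum
    exact zero_ne_one hsum
  have F := S14.fwd p hpos hs α hα0 hα1 ℓ hℓpos hℓ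
  refine ⟨⟨fun h => ?_, S14.bwd p hpos hs hsum α hα0 hα1 ℓ hℓpos hℓ⟩, fun h r hr => ?_⟩
  · simpa using F h 0
  · obtain ⟨n, rfl⟩ : ∃ n, r = n + 1 := ⟨r - 1, by omega⟩
    simpa only [Nat.cast_add, Nat.cast_one] using F h n
end

section
/- Let ℓ be slowly varying at ∞ and suppose ν̄(x) ~ x^{−1} ℓ(1/x) as x → 0+ (rapid variation). Then the integral ℓ_1(y) = ∫_y^∞ u^{−1} ℓ(u) du converges for all sufficiently large y, ℓ_1 is slowly varying at ∞ with ℓ(y)/ℓ_1(y) → 0, and: (i) ν_1[0,x] ~ ℓ_1(1/x) as x → 0+; (ii) for every integer r > 1, ν_r[0,x] ~ (1/(r−1)) x^{r−1} ℓ(1/x) as x → 0+. Conversely, if ν_1[0,x] ~ ℓ_1(1/x) as x → 0+ for some slowly varying ℓ_1, then x ν̄(x) / ℓ_1(1/x) → 0 as x → 0+. -/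
open Filter Topology MeasureTheory

/-- `ℓ_1(y) = ∫_y^∞ u^{-1} ℓ(u) du`. -/
noncomputable def ellOne (ℓ : ℝ → ℝ) (y : ℝ) : ℝ := ∫ u in Set.Ioi y, ℓ u / u

noncomputable def MM (p : ℕ → ℝ) (u : ℝ) : ℝ := ({j | 1 ≤ u * p j}.ncard : ℝ)
noncomputable def MS (p : ℕ → ℝ) (u : ℝ) : ℝ := ({j | 1 < u * p j}.ncard : ℝ)
noncomputable def GG (p : ℕ → ℝ) (r : ℕ) (y : ℝ) : ℝ := ∑' j, min (p j) (1 / y) ^ r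

section aux
variable {p : ℕ → ℝ}

theorem nubar_eq (y : ℝ) (hy : 0 < y) : nubar p (1 / y) = MM p y := by
  unfold nubar MM
  congr 2
  ext j
  simp only [Set.mem_ofPred_eq]
  rw [div_le_iff₀ hy, mul_comm]

theorem fin_M (hs : Summable p) (u : ℝ) : {j | 1 ≤ u * p j}.Finite := by
  have h : Tendsto (fun j => u * p j) atTop (𝓝 0) := by
    simpa using hs.tendsto_atTop_zero.const_mul u
  have h2 := h.eventually (gt_mem_nhds (zero_lt_one))
  rw [← Nat.cofinite_eq_atTop, eventually_cofinite] at h2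
  simpa using h2

theorem fin_S (hs : Summable p) (u : ℝ) : {j | 1 < u * p j}.Finite :=
  (fin_M hs u).subset fun j (hj : 1 < u * p j) => hj.le

theorem hasSum_ncard {s : Set ℕ} (hs : s.Finite) :
    HasSum (s.indicator fun _ => (1 : ℝ)) (s.ncard : ℝ) := by
  have : (s.ncard : ℝ) = ∑ j ∈ hs.toFinset, s.indicator (fun _ => (1 : ℝ)) j := by
    rw [Set.ncard_eq_toFinset_card s hs, Finset.card_eq_sum_ones, Nat.cast_sum]
    refine Finset.sum_congr rfl fun j hj => ?_
    rw [Set.indicator_of_mem (by simpa using hj)]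
    simp
  rw [this]
  exact hasSum_sum_of_ne_finset_zero fun b hb => Set.indicator_of_notMem (by simpa using hb) _

theorem MM_nonneg (u : ℝ) : 0 ≤ MM p u := by unfold MM; positivity
theorem MS_nonneg (u : ℝ) : 0 ≤ MS p u := by unfold MS; positivity

theorem MM_mono (hpos : ∀ j, 0 < p j) (hs : Summable p) : Monotone (MM p) := by
  intro a b hab
  unfold MM
  have := Set.ncard_le_ncard (s := {j | 1 ≤ a * p j}) (t := {j | 1 ≤ b * p j})
    (fun j (hj : 1 ≤ a * p j) => hj.trans (mul_le_mul_of_nonneg_right hab (hpos j).le))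
    (fin_M hs b)
  exact_mod_cast this

theorem MS_le (hs : Summable p) (u : ℝ) : MS p u ≤ MM p u := by
  unfold MM MS
  have := Set.ncard_le_ncard (s := {j | 1 < u * p j}) (t := {j | 1 ≤ u * p j})
    (fun j (hj : 1 < u * p j) => hj.le) (fin_M hs u)
  exact_mod_cast this

theorem le_MS (hpos : ∀ j, 0 < p j) (hs : Summable p) {a u : ℝ} (h : a < u) :
    MM p a ≤ MS p u := by
  unfold MM MS
  have := Set.ncard_le_ncard (s := {j | 1 ≤ a * p j}) (t := {j | 1 < u * p j})
    (fun j (hj : 1 ≤ a * p j) => hj.trans_lt (mul_lt_mul_of_pos_right h (hpos j))) (fin_S hs u)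
  exact_mod_cast this

theorem MM_pos (hpos : ∀ j, 0 < p j) (hs : Summable p) : ∀ᶠ u in atTop, 0 < MM p u := by
  filter_upwards [eventually_ge_atTop (1 / p 0)] with u hu
  unfold MM
  have : 0 < {j | 1 ≤ u * p j}.ncard := by
    rw [Set.ncard_pos (fin_M hs u)]
    exact ⟨0, by rwa [div_le_iff₀ (hpos 0)] at hu⟩
  exact_mod_cast this

theorem summable_min (hpos : ∀ j, 0 < p j) (hs : Summable p) {r : ℕ} (hr : 1 ≤ r) {y : ℝ}
    (hy : 0 < y) : Summable (fun j => min (p j) (1 / y) ^ r) := by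
  refine Summable.of_nonneg_of_le (f := fun j => (1 / y) ^ (r - 1) * p j)
    (fun j => by have := hpos j; positivity) (fun j => ?_) (hs.mul_left _)
  have h0 : 0 ≤ min (p j) (1 / y) := by have := hpos j; positivity
  obtain ⟨k, rfl⟩ : ∃ k, r = k + 1 := ⟨r - 1, by omega⟩
  rw [pow_succ]
  simp only [Nat.add_sub_cancel]
  gcongr
  · exact min_le_right _ _
  · exact min_le_left _ _

theorem GG_pos (hpos : ∀ j, 0 < p j) (hs : Summable p) {r : ℕ} (hr : 1 ≤ r) {y : ℝ}
    (hy : 0 < y) : 0 < GG p r y :=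
  (summable_min hpos hs hr hy).tsum_pos (fun j => by have := hpos j; positivity) 0
    (by have := hpos 0; positivity)

theorem GG_anti (hpos : ∀ j, 0 < p j) (hs : Summable p) {a b : ℝ} (ha : 0 < a) (hab : a ≤ b) :
    GG p 1 b ≤ GG p 1 a := by
  refine (summable_min hpos hs le_rfl (ha.trans_le hab)).tsum_le_tsum (fun j => ?_)
    (summable_min hpos hs le_rfl ha)
  have : 1 / b ≤ 1 / a := one_div_le_one_div_of_le ha hab
  simp only [pow_one]
  exact min_le_min le_rfl this

theorem GG_step (hpos : ∀ j, 0 < p j) (hs : Summable p) {y : ℝ} (hy : 0 < y) :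
    GG p 1 (2 * y) + MM p y / y / 2 ≤ GG p 1 y := by
  have h1 := (summable_min hpos hs le_rfl (y := 2 * y) (by positivity)).hasSum
  have h2 := (summable_min hpos hs le_rfl hy).hasSum
  have h3 := (hasSum_ncard (fin_M hs y)).mul_left (1 / (2 * y))
  have h4 := hasSum_le (fun j => ?_) (h1.add h3) h2
  · unfold GG MM
    refine le_trans (le_of_eq ?_) h4
    congr 1
    field_simp
  · have hd : 1 / y = 1 / (2 * y) + 1 / (2 * y) := by field_simp; norm_num
    have hd0 : 0 < 1 / (2 * y) := by positivity
    simp only [pow_one]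
    by_cases hj : 1 ≤ y * p j
    · rw [Set.indicator_of_mem (by simpa using hj)]
      have : 1 / y ≤ p j := by rwa [div_le_iff₀' hy]
      rw [min_eq_right this, min_eq_right (by linarith)]
      linarith
    · rw [Set.indicator_of_notMem (by simpa using hj)]
      simp only [mul_zero, add_zero]
      exact min_le_min le_rfl (by linarith)

theorem GG_step2 (hpos : ∀ j, 0 < p j) (hs : Summable p) {y c : ℝ} (hy : 0 < y) (hc : 1 ≤ c) :
    GG p 1 y ≤ GG p 1 (c * y) + (c - 1) * (MM p (c * y) / (c * y)) := by
  have hc0 : 0 < c := by linarith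
  have h1 := (summable_min hpos hs le_rfl (y := c * y) (by positivity)).hasSum
  have h2 := (summable_min hpos hs le_rfl hy).hasSum
  have h3 := (hasSum_ncard (fin_M hs (c * y))).mul_left ((c - 1) * (1 / (c * y)))
  have h4 := hasSum_le (fun j => ?_) h2 (h1.add h3)
  · unfold GG MM
    refine h4.trans (le_of_eq ?_)
    congr 1
    field_simp
  · have hd : 1 / y = 1 / (c * y) + (c - 1) * (1 / (c * y)) := by field_simp; ring
    have hd0 : 0 < 1 / (c * y) := by positivity
    simp only [pow_one]
    by_cases hj : 1 ≤ c * y * p j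
    · rw [Set.indicator_of_mem (by simpa using hj)]
      have : 1 / (c * y) ≤ p j := by rwa [div_le_iff₀' (by positivity)]
      rw [min_eq_right this]
      exact (min_le_right _ _).trans (by linarith)
    · rw [Set.indicator_of_notMem (by simpa using hj)]
      have : p j ≤ 1 / (c * y) := by
        rw [le_div_iff₀' (by positivity)]; exact (not_le.1 hj).le
      rw [min_eq_left this]
      simp

theorem nuR_eq (hpos : ∀ j, 0 < p j) (hs : Summable p) {r : ℕ} (hr : 1 ≤ r) {y : ℝ}
    (hy : 0 < y) : nuR p r (1 / y) = GG p r y - (1 / y) ^ r * MS p y := by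
  have h2 := (summable_min hpos hs hr hy).hasSum
  have h3 := (hasSum_ncard (fin_S hs y)).mul_left ((1 / y) ^ r)
  have h4 := (h2.sub h3).tsum_eq
  unfold nuR GG MS
  rw [← h4]
  refine tsum_congr fun j => ?_
  by_cases hj : 1 < y * p j
  · rw [Set.indicator_of_mem (by simpa using hj)]
    have : 1 / y < p j := by rwa [div_lt_iff₀' hy]
    rw [min_eq_right this.le, if_neg (not_le.2 this)]
    ring
  · rw [Set.indicator_of_notMem (by simpa using hj)]
    have : p j ≤ 1 / y := by
      rw [le_div_iff₀' hy]; exact not_lt.1 hj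
    rw [min_eq_left this, if_pos this]
    ring

theorem GG_int (hpos : ∀ j, 0 < p j) (hs : Summable p) {r : ℕ} (hr : 1 ≤ r) {y : ℝ}
    (hy : 0 < y) :
    GG p r y = ∫ u in Set.Ioi y, (r * u ^ (-((r : ℝ) + 1))) * MM p u := by
  have hr' : (1 : ℝ) ≤ r := by exact_mod_cast hr
  set f : ℝ → ℝ := fun u => r * u ^ (-((r : ℝ) + 1)) with hf
  let F : ℕ → ℝ → ℝ := fun j => (Set.Ici (1 / p j)).indicator f
  have hfint : IntegrableOn f (Set.Ioi y) :=
    (integrableOn_Ioi_rpow_of_lt (by linarith) hy).const_mul _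
  have hFint : ∀ j, Integrable (F j) (volume.restrict (Set.Ioi y)) := fun j =>
    hfint.integrable.indicator measurableSet_Ici
  have hval : ∀ j, ∫ u in Set.Ioi y, F j u = min (p j) (1 / y) ^ r := by
    intro j
    have hp := hpos j
    have hm : 0 < max y (1 / p j) := lt_max_of_lt_left hy
    have h1 : ∫ u in Set.Ioi y, F j u = ∫ u in Set.Ioi (max y (1 / p j)), f u := by
      rw [← Set.Ioi_inter_Ioi, ← setIntegral_indicator measurableSet_Ioi]
      refine integral_congr_ae ?_
      refine ae_restrict_of_ae ?_
      have : ∀ᵐ u : ℝ, u ≠ 1 / p j := by simp [ae_iff]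
      filter_upwards [this] with u hu
      simp only [F, Set.indicator, Set.mem_Ici, Set.mem_Ioi]
      congr 1
      simp only [eq_iff_iff]
      exact ⟨fun h => lt_of_le_of_ne h hu.symm, le_of_lt⟩
    rw [h1, hf, integral_const_mul, integral_Ioi_rpow_of_lt (by linarith) hm]
    have e : -((r : ℝ) + 1) + 1 = -r := by ring
    rw [e, Real.rpow_neg hm.le, Real.rpow_natCast]
    have e2 : min (p j) (1 / y) = (max y (1 / p j))⁻¹ := by
      rcases le_total y (1 / p j) with h | h
      · rw [max_eq_right h, min_eq_left]
        · simp
        · rw [le_div_iff₀ hp] at h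
          rw [le_div_iff₀ hy]; linarith
      · rw [max_eq_left h, min_eq_right]
        · simp
        · rw [div_le_iff₀ hp] at h
          rw [div_le_iff₀ hy]; linarith
    rw [e2, inv_pow]
    field_simp
  have hF0 : ∀ j, ∫ u in Set.Ioi y, ‖F j u‖ = ∫ u in Set.Ioi y, F j u := by
    intro j
    refine setIntegral_congr_fun measurableSet_Ioi fun u hu => ?_
    have hu' : 0 < u := hy.trans hu
    have : 0 ≤ F j u := by
      simp only [F, Set.indicator, hf]; split_ifs <;> positivity
    simp [abs_of_nonneg this]
  have H := hasSum_integral_of_summable_integral_norm hFint (by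
    simp only [hF0, hval]; exact summable_min hpos hs hr hy)
  simp only [hval] at H
  unfold GG
  rw [H.tsum_eq]
  congr 1
  ext u
  have h3 := (hasSum_ncard (fin_M hs u)).mul_left (f u)
  unfold MM
  rw [← h3.tsum_eq]
  refine tsum_congr fun j => ?_
  simp only [F, Set.indicator, Set.mem_Ici, Set.mem_ofPred_eq, div_le_iff₀ (hpos j)]
  split_ifs <;> simp

theorem asym1 (hpos : ∀ j, 0 < p j) (hs : Summable p)
    (hM : ∀ c : ℝ, 0 < c → Tendsto (fun y => MM p (c * y) / MM p y) atTop (𝓝 c)) :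
    Tendsto (fun y => MM p y / y / GG p 1 y) atTop (𝓝 0) := by
  have hsum : ∀ n : ℕ, ∀ y : ℝ, 0 < y →
      ∑ k ∈ Finset.range n, MM p (2 ^ k * y) / (2 ^ k * y) / 2 + GG p 1 (2 ^ n * y)
        ≤ GG p 1 y := by
    intro n y hy
    induction n with
    | zero => simp
    | succ n ih =>
      rw [Finset.sum_range_succ]
      have := GG_step hpos hs (y := 2 ^ n * y) (by positivity)
      rw [← mul_assoc, ← pow_succ'] at this
      linarith
  have key : Tendsto (fun y => GG p 1 y / (MM p y / y)) atTop atTop := by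
    rw [tendsto_atTop]
    intro C
    obtain ⟨n, hn⟩ := exists_nat_gt (2 * C)
    have hlim : Tendsto (fun y => ∑ k ∈ Finset.range n,
        (MM p (2 ^ k * y) / MM p y) / 2 ^ k / 2) atTop
        (𝓝 (∑ k ∈ Finset.range n, ((2 : ℝ) ^ k) / 2 ^ k / 2)) :=
      tendsto_finsetSum _ fun k _ => ((hM (2 ^ k) (by positivity)).div_const _).div_const _
    have hv : (∑ k ∈ Finset.range n, ((2 : ℝ) ^ k) / 2 ^ k / 2) = n / 2 := by
      simp; ring
    rw [hv] at hlim
    filter_upwards [hlim.eventually (lt_mem_nhds (show C < n / 2 by linarith)),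
      MM_pos hpos hs, eventually_gt_atTop 0] with y h1 h2 hy
    rw [le_div_iff₀ (by positivity)]
    have h3 := hsum n y hy
    have h4 := (GG_pos hpos hs le_rfl (y := 2 ^ n * y) (by positivity)).le
    have h5 : (∑ k ∈ Finset.range n, (MM p (2 ^ k * y) / MM p y) / 2 ^ k / 2) * (MM p y / y)
        = ∑ k ∈ Finset.range n, MM p (2 ^ k * y) / (2 ^ k * y) / 2 := by
      rw [Finset.sum_mul]
      refine Finset.sum_congr rfl fun k _ => ?_
      field_simp
    have h6 : 0 ≤ MM p y / y := by positivity
    nlinarith [mul_le_mul_of_nonneg_right h1.le h6]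
  refine key.inv_tendsto_atTop.congr fun y => ?_
  simp

theorem asym2_ge (hpos : ∀ j, 0 < p j) (hs : Summable p)
    (hM : ∀ c : ℝ, 0 < c → Tendsto (fun y => MM p (c * y) / MM p y) atTop (𝓝 c))
    (c : ℝ) (hc : 1 ≤ c) : Tendsto (fun y => GG p 1 (c * y) / GG p 1 y) atTop (𝓝 1) := by
  have hc0 : 0 < c := by linarith
  have h1 := (asym1 hpos hs hM).comp (tendsto_id.const_mul_atTop hc0)
  have h2 : Tendsto (fun y => 1 - (c - 1) * (MM p (c * y) / (c * y) / GG p 1 (c * y)))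
      atTop (𝓝 1) := by
    have := (h1.const_mul (c - 1)).const_sub 1
    simpa using this
  refine tendsto_of_tendsto_of_tendsto_of_le_of_le' h2 tendsto_const_nhds ?_ ?_
  · filter_upwards [eventually_gt_atTop 0] with y hy
    have hy' : 0 < c * y := by positivity
    have g1 := GG_pos hpos hs le_rfl hy
    have g2 := GG_pos hpos hs le_rfl hy'
    have g3 := GG_anti hpos hs hy (b := c * y) (by nlinarith)
    have g4 := GG_step2 hpos hs hy hc
    have g5 : 0 ≤ MM p (c * y) / (c * y) := div_nonneg (MM_nonneg _) hy'.le
    have g6 : MM p (c * y) / (c * y) / GG p 1 y ≤ MM p (c * y) / (c * y) / GG p 1 (c * y) := by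
      gcongr
    have g7 : GG p 1 y / GG p 1 y ≤
      (GG p 1 (c * y) + (c - 1) * (MM p (c * y) / (c * y))) / GG p 1 y := by gcongr
    rw [div_self g1.ne', add_div, mul_div_assoc] at g7
    have : (c - 1) * (MM p (c * y) / (c * y) / GG p 1 y) ≤
      (c - 1) * (MM p (c * y) / (c * y) / GG p 1 (c * y)) :=
      mul_le_mul_of_nonneg_left g6 (by linarith)
    linarith
  · filter_upwards [eventually_gt_atTop 0] with y hy
    rw [div_le_one (GG_pos hpos hs le_rfl hy)]
    exact GG_anti hpos hs hy (b := c * y) (by nlinarith)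

theorem asym2 (hpos : ∀ j, 0 < p j) (hs : Summable p)
    (hM : ∀ c : ℝ, 0 < c → Tendsto (fun y => MM p (c * y) / MM p y) atTop (𝓝 c))
    (c : ℝ) (hc : 0 < c) : Tendsto (fun y => GG p 1 (c * y) / GG p 1 y) atTop (𝓝 1) := by
  rcases le_total 1 c with h | h
  · exact asym2_ge hpos hs hM c h
  · have h1 := (asym2_ge hpos hs hM c⁻¹ ((one_le_inv₀ hc).2 h)).comp
      (tendsto_id.const_mul_atTop hc)
    have h2 := h1.inv₀ one_ne_zero
    rw [inv_one] at h2
    refine h2.congr fun y => ?_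
    simp [hc.ne']

theorem asym3 (hpos : ∀ j, 0 < p j) (hs : Summable p)
    (hM : ∀ c : ℝ, 0 < c → Tendsto (fun y => MM p (c * y) / MM p y) atTop (𝓝 c)) :
    Tendsto (fun y => MS p y / MM p y) atTop (𝓝 1) := by
  rw [tendsto_order]
  constructor
  · intro a ha
    obtain ⟨c, hc, hc1⟩ := exists_between (max_lt ha one_pos)
    have hc0 : 0 < c := (le_max_right _ _).trans_lt hc
    filter_upwards [(hM c hc0).eventually (lt_mem_nhds ((le_max_left _ _).trans_lt hc)),
      MM_pos hpos hs, eventually_gt_atTop 0] with y h1 h2 hy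
    refine h1.trans_le ?_
    gcongr
    exact le_MS hpos hs (by nlinarith)
  · intro a ha
    filter_upwards [MM_pos hpos hs] with y h2
    refine lt_of_le_of_lt ?_ ha
    rw [div_le_one h2]
    exact MS_le hs y

theorem potter (hpos : ∀ j, 0 < p j) (hs : Summable p)
    (hM : ∀ c : ℝ, 0 < c → Tendsto (fun y => MM p (c * y) / MM p y) atTop (𝓝 c)) :
    ∀ᶠ y in atTop, ∀ v : ℝ, 1 ≤ v → MM p (y * v) / MM p y ≤ 8 * v ^ (3 / 2 : ℝ) := by
  have h4 := ((hM 4 (by norm_num)).eventually (gt_mem_nhds (show (4 : ℝ) < 8 by norm_num)))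
  obtain ⟨Y, hY⟩ := eventually_atTop.1 (h4.and ((MM_pos hpos hs).and (eventually_gt_atTop 0)))
  filter_upwards [eventually_ge_atTop Y] with y hy v hv
  have hy0 : 0 < y := (hY y hy).2.2
  have hm0 := (hY y hy).2.1
  have step : ∀ n : ℕ, MM p (4 ^ n * y) ≤ 8 ^ n * MM p y := by
    intro n
    induction n with
    | zero => simp
    | succ n ih =>
      have hge : Y ≤ 4 ^ n * y := by
        have : (1 : ℝ) ≤ 4 ^ n := one_le_pow₀ (by norm_num)
        nlinarith
      obtain ⟨a1, a2, a3⟩ := hY _ hge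
      rw [div_lt_iff₀ a2] at a1
      rw [pow_succ', pow_succ', mul_assoc]
      nlinarith
  obtain ⟨n, hn1, hn2⟩ := exists_nat_pow_near hv (show (1 : ℝ) < 4 by norm_num)
  have h1 : MM p (y * v) ≤ MM p (4 ^ (n + 1) * y) := MM_mono hpos hs (by nlinarith)
  have h2 := step (n + 1)
  rw [div_le_iff₀ hm0]
  refine (h1.trans h2).trans ?_
  gcongr
  rw [pow_succ']
  gcongr
  calc (8 : ℝ) ^ n = ((4 : ℝ) ^ n) ^ (3 / 2 : ℝ) := by
        rw [← Real.rpow_natCast, ← Real.rpow_natCast, ← Real.rpow_mul (by norm_num), mul_comm,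
          Real.rpow_mul (by norm_num)]
        congr 1
        rw [show (4 : ℝ) = 2 ^ (2 : ℝ) by norm_num, ← Real.rpow_mul (by norm_num)]
        norm_num
    _ ≤ v ^ (3 / 2 : ℝ) := by gcongr

theorem karamata (hpos : ∀ j, 0 < p j) (hs : Summable p)
    (hM : ∀ c : ℝ, 0 < c → Tendsto (fun y => MM p (c * y) / MM p y) atTop (𝓝 c))
    (r : ℕ) (hr : 1 < r) :
    Tendsto (fun y => GG p r y * y ^ r / MM p y) atTop (𝓝 (r / ((r : ℝ) - 1))) := by
  have hr' : (2 : ℝ) ≤ r := by exact_mod_cast hr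
  have hD : Tendsto (fun y => ∫ v in Set.Ioi (1 : ℝ),
      v ^ (-((r : ℝ) + 1)) * (MM p (y * v) / MM p y)) atTop
      (𝓝 (∫ v in Set.Ioi (1 : ℝ), v ^ (-((r : ℝ) + 1)) * v)) := by
    refine tendsto_integral_filter_of_dominated_convergence
      (fun v => 8 * v ^ (-((r : ℝ) + 1) + 3 / 2)) ?_ ?_ ?_ ?_
    · filter_upwards with y
      have := (MM_mono hpos hs).measurable
      apply Measurable.aestronglyMeasurable
      fun_prop
    · filter_upwards [potter hpos hs hM] with y hy
      filter_upwards [ae_restrict_mem measurableSet_Ioi] with v hv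
      have hv' : (1 : ℝ) < v := hv
      have hv0 : 0 < v := by linarith
      have h0 : 0 ≤ MM p (y * v) / MM p y := div_nonneg (MM_nonneg _) (MM_nonneg _)
      rw [Real.norm_of_nonneg (by positivity), Real.rpow_add hv0]
      have := mul_le_mul_of_nonneg_left (hy v hv'.le)
        (show 0 ≤ v ^ (-((r : ℝ) + 1)) by positivity)
      linarith
    · exact (integrableOn_Ioi_rpow_of_lt (by linarith) one_pos).const_mul _
    · filter_upwards [ae_restrict_mem measurableSet_Ioi] with v hv
      have hv' : (1 : ℝ) < v := hv
      have := (hM v (by linarith)).const_mul (v ^ (-((r : ℝ) + 1)))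
      simpa only [mul_comm v] using this
  have hval : (∫ v in Set.Ioi (1 : ℝ), v ^ (-((r : ℝ) + 1)) * v) = 1 / ((r : ℝ) - 1) := by
    have : (∫ v in Set.Ioi (1 : ℝ), v ^ (-((r : ℝ) + 1)) * v)
        = ∫ v in Set.Ioi (1 : ℝ), v ^ (-(r : ℝ)) := by
      refine setIntegral_congr_fun measurableSet_Ioi fun v hv => ?_
      have hv' : (1 : ℝ) < v := hv
      rw [← Real.rpow_add_one (by linarith)]
      congr 1
      ring
    rw [this, integral_Ioi_rpow_of_lt (by linarith) one_pos, Real.one_rpow]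
    rw [← neg_div_neg_eq]
    congr 1 <;> ring
  rw [hval] at hD
  have hD2 := hD.const_mul (r : ℝ)
  rw [mul_one_div] at hD2
  refine hD2.congr' ?_
  filter_upwards [MM_pos hpos hs, eventually_gt_atTop 0] with y hm hy
  have h1 := integral_comp_mul_left_Ioi
    (fun u => (r * u ^ (-((r : ℝ) + 1))) * MM p u) 1 hy
  rw [mul_one, ← GG_int hpos hs hr.le hy, smul_eq_mul] at h1
  have h2 : GG p r y = y * ∫ v in Set.Ioi (1 : ℝ),
      (r * (y * v) ^ (-((r : ℝ) + 1))) * MM p (y * v) := by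
    rw [h1]; field_simp
  have h3 : (∫ v in Set.Ioi (1 : ℝ), (r * (y * v) ^ (-((r : ℝ) + 1))) * MM p (y * v))
      = ∫ v in Set.Ioi (1 : ℝ), (r * (y ^ (r + 1))⁻¹ * MM p y) *
        (v ^ (-((r : ℝ) + 1)) * (MM p (y * v) / MM p y)) := by
    refine setIntegral_congr_fun measurableSet_Ioi fun v hv => ?_
    have hv' : (1 : ℝ) < v := hv
    rw [Real.mul_rpow hy.le (by linarith), Real.rpow_neg hy.le]
    have : y ^ ((r : ℝ) + 1) = y ^ (r + 1) := by
      rw [← Real.rpow_natCast]; push_cast; rfl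
    rw [this]
    field_simp
  rw [h2, h3, integral_const_mul]
  field_simp
  ring

theorem GG_int_one (hpos : ∀ j, 0 < p j) (hs : Summable p) {y : ℝ} (hy : 0 < y) :
    GG p 1 y = ∫ u in Set.Ioi y, MM p u / u / u := by
  rw [GG_int hpos hs le_rfl hy]
  refine setIntegral_congr_fun measurableSet_Ioi fun u hu => ?_
  have hu' : 0 < u := hy.trans hu
  rw [show -(((1 : ℕ) : ℝ) + 1) = -((2 : ℕ) : ℝ) by norm_num, Real.rpow_neg hu'.le,
    Real.rpow_natCast]
  field_simp
  simp

theorem int_one (hpos : ∀ j, 0 < p j) (hs : Summable p) {y : ℝ} (hy : 0 < y) :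
    IntegrableOn (fun u => MM p u / u / u) (Set.Ioi y) := by
  by_contra h
  have h1 := GG_int_one hpos hs hy
  rw [integral_undef h] at h1
  exact (GG_pos hpos hs le_rfl hy).ne' h1

theorem ell_ev (hpos : ∀ j, 0 < p j) (hs : Summable p) {ℓ : ℝ → ℝ}
    (h : Tendsto (fun y => MM p y / (y * ℓ y)) atTop (𝓝 1)) {ε : ℝ} (hε : 0 < ε) :
    ∃ Y : ℝ, 0 < Y ∧ ∀ u, Y ≤ u → (1 - ε) * (MM p u / u / u) ≤ ℓ u / u ∧
      ℓ u / u ≤ (1 + ε) * (MM p u / u / u) := by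
  have h1 := h.inv₀ one_ne_zero
  rw [inv_one] at h1
  have h2 := (h1.eventually (lt_mem_nhds (show 1 - ε < 1 by linarith))).and
    ((h1.eventually (gt_mem_nhds (show 1 < 1 + ε by linarith))).and
    ((MM_pos hpos hs).and (eventually_gt_atTop 0)))
  obtain ⟨Y, hY⟩ := eventually_atTop.1 h2
  refine ⟨Y, (hY Y le_rfl).2.2.2, fun u hu => ?_⟩
  obtain ⟨a1, a2, a3, a4⟩ := hY u hu
  have e : ℓ u / u = (MM p u / (u * ℓ u))⁻¹ * (MM p u / u / u) := by
    rw [inv_div]; field_simp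
  have h0 : 0 ≤ MM p u / u / u := by positivity
  rw [e]
  exact ⟨mul_le_mul_of_nonneg_right a1.le h0, mul_le_mul_of_nonneg_right a2.le h0⟩

theorem ell_int (hpos : ∀ j, 0 < p j) (hs : Summable p) {ℓ : ℝ → ℝ} (hm : Measurable ℓ)
    (hl : ∀ y : ℝ, 0 < y → 0 < ℓ y)
    (h : Tendsto (fun y => MM p y / (y * ℓ y)) atTop (𝓝 1)) :
    ∃ y₀ : ℝ, 0 < y₀ ∧ ∀ y : ℝ, y₀ ≤ y →
        IntegrableOn (fun u : ℝ => ℓ u / u) (Set.Ioi y) := by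
  obtain ⟨Y, hY0, hY⟩ := ell_ev hpos hs h one_pos
  refine ⟨Y, hY0, fun y hy => ?_⟩
  refine Integrable.mono' ((int_one hpos hs (hY0.trans_le hy)).const_mul (1 + 1))
    (by apply Measurable.aestronglyMeasurable; fun_prop) ?_
  filter_upwards [ae_restrict_mem measurableSet_Ioi] with u hu
  have hu' : y < u := hu
  have hu0 : 0 < u := by linarith
  have := hl u hu0
  rw [Real.norm_of_nonneg (by positivity)]
  exact (hY u (by linarith)).2

theorem ell_asym (hpos : ∀ j, 0 < p j) (hs : Summable p) {ℓ : ℝ → ℝ} (hm : Measurable ℓ)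
    (hl : ∀ y : ℝ, 0 < y → 0 < ℓ y)
    (h : Tendsto (fun y => MM p y / (y * ℓ y)) atTop (𝓝 1)) :
    Tendsto (fun y => ellOne ℓ y / GG p 1 y) atTop (𝓝 1) := by
  obtain ⟨y₀, hy₀, hint⟩ := ell_int hpos hs hm hl h
  rw [Metric.tendsto_nhds]
  intro ε hε
  obtain ⟨Y, hY0, hY⟩ := ell_ev hpos hs h (half_pos hε)
  filter_upwards [eventually_ge_atTop Y, eventually_ge_atTop y₀] with y h1 h2
  have hy := hY0.trans_le h1
  have g := GG_pos hpos hs le_rfl hy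
  have i1 := int_one hpos hs hy
  have i2 := hint y h2
  have a1 := setIntegral_mono_on (i1.const_mul (1 - ε / 2)) i2 measurableSet_Ioi
    fun u hu => (hY u (h1.trans (le_of_lt hu))).1
  have a2 := setIntegral_mono_on i2 (i1.const_mul (1 + ε / 2)) measurableSet_Ioi
    fun u hu => (hY u (h1.trans (le_of_lt hu))).2
  rw [integral_const_mul, ← GG_int_one hpos hs hy] at a1 a2
  rw [← le_div_iff₀ g] at a1
  rw [← div_le_iff₀ g] at a2
  change ellOne ℓ y / _ ≤ _ at a2
  change _ ≤ ellOne ℓ y / _ at a1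
  rw [Real.dist_eq, abs_lt]
  constructor <;> linarith

theorem V_anti (hpos : ∀ j, 0 < p j) (hs : Summable p) {a b : ℝ} (hab : a ≤ b) :
    nuR p 1 a ≤ nuR p 1 b := by
  have hsum : ∀ x : ℝ, Summable fun j => if p j ≤ x then p j ^ 1 else 0 := fun x =>
    Summable.of_nonneg_of_le (fun j => by have := hpos j; split_ifs <;> positivity)
      (fun j => by have := hpos j; split_ifs <;> simp [this.le]) hs
  refine (hsum a).tsum_le_tsum (fun j => ?_) (hsum b)
  have := hpos j
  split_ifs <;> first | linarith | positivity

theorem V_pos (hpos : ∀ j, 0 < p j) (hs : Summable p) {x : ℝ} (hx : 0 < x) :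
    0 < nuR p 1 x := by
  have hsum : Summable fun j => if p j ≤ x then p j ^ 1 else 0 :=
    Summable.of_nonneg_of_le (fun j => by have := hpos j; split_ifs <;> positivity)
      (fun j => by have := hpos j; split_ifs <;> simp [this.le]) hs
  obtain ⟨j, hj⟩ := (hs.tendsto_atTop_zero.eventually (gt_mem_nhds hx)).exists
  refine hsum.tsum_pos (fun j => by have := hpos j; split_ifs <;> positivity) j ?_
  rw [if_pos hj.le]
  simpa using hpos j

theorem V_step (hpos : ∀ j, 0 < p j) (hs : Summable p) {y : ℝ} (hy : 0 < y) :
    1 / (2 * y) * MM p (2 * y) + nuR p 1 (1 / (4 * y)) ≤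
      1 / (2 * y) * MM p y + nuR p 1 (1 / y) := by
  have hsum : ∀ x : ℝ, Summable fun j => if p j ≤ x then p j ^ 1 else 0 := fun x =>
    Summable.of_nonneg_of_le (fun j => by have := hpos j; split_ifs <;> positivity)
      (fun j => by have := hpos j; split_ifs <;> simp [this.le]) hs
  have h1 := ((hasSum_ncard (fin_M hs (2 * y))).mul_left (1 / (2 * y))).add
    (hsum (1 / (4 * y))).hasSum
  have h2 := ((hasSum_ncard (fin_M hs y)).mul_left (1 / (2 * y))).add
    (hsum (1 / y)).hasSum
  refine hasSum_le (fun j => ?_) h1 h2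
  have hp := hpos j
  simp only [Set.indicator, Set.mem_ofPred_eq, pow_one]
  have e1 : (1 ≤ 2 * y * p j) ↔ 1 / (2 * y) ≤ p j := by rw [div_le_iff₀' (by positivity)]
  have e2 : (1 ≤ y * p j) ↔ 1 / y ≤ p j := by rw [div_le_iff₀' (by positivity)]
  have d1 : 1 / y = 4 * (1 / (4 * y)) := by field_simp
  have d2 : 1 / (2 * y) = 2 * (1 / (4 * y)) := by field_simp; norm_num
  have d3 : 0 < 1 / (4 * y) := by positivity
  simp only [e1, e2, d1, d2]
  generalize 1 / (4 * y) = d at *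
  split_ifs <;> linarith

theorem V_main (hpos : ∀ j, 0 < p j) (hs : Summable p)
    (hV : ∀ c : ℝ, 0 < c →
      Tendsto (fun y => nuR p 1 (1 / (c * y)) / nuR p 1 (1 / y)) atTop (𝓝 1)) :
    Tendsto (fun y => MM p y / (y * nuR p 1 (1 / y))) atTop (𝓝 0) := by
  set V : ℝ → ℝ := fun y => nuR p 1 (1 / y) with hVd
  set h : ℝ → ℝ := fun y => MM p y / (y * V y) with hh
  have hVp : ∀ y, 0 < y → 0 < V y := fun y hy => V_pos hpos hs (by positivity)
  have hh0 : ∀ y, 0 < y → 0 ≤ h y := fun y hy =>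
    div_nonneg (MM_nonneg _) (mul_pos hy (hVp y hy)).le
  have l1 : Tendsto (fun y => V y / V (2 * y)) atTop (𝓝 1) := by
    have := (hV 2 two_pos).inv₀ one_ne_zero
    rw [inv_one] at this
    exact this.congr fun y => by rw [inv_div]
  have l2 : Tendsto (fun y => V (4 * y) / V (2 * y)) atTop (𝓝 1) := by
    have := (hV 2 two_pos).comp (tendsto_id.const_mul_atTop (two_pos (α := ℝ)))
    refine this.congr fun y => ?_
    simp only [hVd, Function.comp, id]
    rw [← mul_assoc]; norm_num
  have l3 : Tendsto (fun y => V y / V (2 * y) - V (4 * y) / V (2 * y)) atTop (𝓝 0) := by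
    simpa using l1.sub l2
  rw [Metric.tendsto_nhds]
  intro ε hε
  have ev := (l1.eventually (gt_mem_nhds (show (1 : ℝ) < 3 / 2 by norm_num))).and
    ((l3.eventually (gt_mem_nhds (show (0 : ℝ) < ε / 8 by positivity))).and
      (eventually_gt_atTop 0))
  obtain ⟨Y, hY⟩ := eventually_atTop.1 ev
  have hY0 : 0 < Y := (hY Y le_rfl).2.2
  have step : ∀ y, Y ≤ y → h (2 * y) ≤ 3 / 4 * h y + ε / 8 := by
    intro y hy
    obtain ⟨a1, a2, a3⟩ := hY y hy
    have v1 := hVp y a3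
    have v2 := hVp (2 * y) (by positivity)
    have s := V_step hpos hs a3
    change _ + V (4 * y) ≤ _ + V y at s
    have s2 : 1 / (2 * y) * MM p (2 * y) / V (2 * y) ≤
        (1 / (2 * y) * MM p y + V y - V (4 * y)) / V (2 * y) := by
      gcongr; linarith
    have e1 : 1 / (2 * y) * MM p (2 * y) / V (2 * y) = h (2 * y) := by
      simp only [hh]; field_simp
    have e2 : (1 / (2 * y) * MM p y + V y - V (4 * y)) / V (2 * y) =
        1 / 2 * (V y / V (2 * y)) * h y + (V y / V (2 * y) - V (4 * y) / V (2 * y)) := by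
      simp only [hh]; field_simp; ring
    rw [e1, e2] at s2
    nlinarith [hh0 y a3]
  have iter : ∀ n : ℕ, ∀ y, Y ≤ y → h (2 ^ n * y) ≤ (3 / 4) ^ n * h y + ε / 2 := by
    intro n y hy
    induction n with
    | zero => simp; positivity
    | succ n ih =>
      have hge : Y ≤ 2 ^ n * y := by
        have : (1 : ℝ) ≤ 2 ^ n := one_le_pow₀ (by norm_num)
        nlinarith
      have := step _ hge
      rw [pow_succ' (2 : ℝ), pow_succ', mul_assoc]
      nlinarith
  set C : ℝ := MM p (2 * Y) / (Y * V (2 * Y)) with hC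
  have hCb : ∀ y, Y ≤ y → y ≤ 2 * Y → h y ≤ C := by
    intro y h1 h2
    have v2 := hVp (2 * Y) (by positivity)
    have hy0 := hY0.trans_le h1
    have hv : V (2 * Y) ≤ V y := V_anti hpos hs (one_div_le_one_div_of_le hy0 h2)
    have hm := MM_mono hpos hs h2
    have := MM_nonneg (p := p) (2 * Y)
    simp only [hh, hC]
    gcongr
  have hpow : Tendsto (fun n : ℕ => (3 / 4 : ℝ) ^ n * C) atTop (𝓝 0) := by
    simpa using (tendsto_pow_atTop_nhds_zero_of_lt_one (by norm_num)
      (show (3 / 4 : ℝ) < 1 by norm_num)).mul_const C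
  obtain ⟨N, hN⟩ := eventually_atTop.1
    (hpow.eventually (gt_mem_nhds (show (0 : ℝ) < ε / 2 by positivity)))
  filter_upwards [eventually_ge_atTop (2 ^ N * Y)] with y hy
  have hyY : 2 ^ N ≤ y / Y := by rwa [le_div_iff₀ hY0]
  have h1N : (1 : ℝ) ≤ 2 ^ N := one_le_pow₀ (by norm_num)
  obtain ⟨n, hn1, hn2⟩ := exists_nat_pow_near (h1N.trans hyY) (show (1 : ℝ) < 2 by norm_num)
  have hNn : N ≤ n := by
    have := (pow_lt_pow_iff_right₀ (show (1 : ℝ) < 2 by norm_num)).1 (hyY.trans_lt hn2)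
    omega
  have hp2 : (0 : ℝ) < 2 ^ n := by positivity
  rw [le_div_iff₀ hY0] at hn1
  rw [div_lt_iff₀ hY0, pow_succ] at hn2
  have b1 : Y ≤ y / 2 ^ n := by rw [le_div_iff₀ hp2]; linarith
  have b2 : y / 2 ^ n ≤ 2 * Y := by rw [div_le_iff₀ hp2]; linarith
  have b3 := iter n _ b1
  rw [mul_div_cancel₀ _ hp2.ne'] at b3
  have b4 := hCb _ b1 b2
  have b5 := hN n hNn
  have b6 : (3 / 4 : ℝ) ^ n * h (y / 2 ^ n) ≤ (3 / 4 : ℝ) ^ n * C := by gcongr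
  have hy0 : 0 < y := by nlinarith
  rw [Real.dist_eq, sub_zero, abs_of_nonneg (hh0 y hy0)]
  linarith

theorem to_zero {F : ℝ → ℝ} {l : Filter ℝ} (h : Tendsto (fun y => F (1 / y)) atTop l) :
    Tendsto F (𝓝[>] 0) l := by
  refine (h.comp tendsto_inv_nhdsGT_zero).congr fun x => ?_
  simp

theorem from_zero {F : ℝ → ℝ} {l : Filter ℝ} (h : Tendsto F (𝓝[>] 0) l) :
    Tendsto (fun y => F (1 / y)) atTop l := by
  refine (h.comp tendsto_inv_atTop_nhdsGT_zero).congr fun x => ?_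
  simp

end aux

/-- Rapid variation: if `ν̄(x) ∼ x^{-1} ℓ(1/x)` with `ℓ` slowly varying, then
`ℓ_1(y) = ∫_y^∞ u^{-1} ℓ(u) du` converges for all large `y`, is slowly varying
with `ℓ ≪ ℓ_1`, and (i) `ν_1[0,x] ∼ ℓ_1(1/x)`, (ii) for `r > 1`,
`ν_r[0,x] ∼ (1/(r−1)) x^{r−1} ℓ(1/x)`. Conversely, `ν_1[0,x] ∼ ℓ_1(1/x)` for
some slowly varying `ℓ_1` implies `x ν̄(x) ≪ ℓ_1(1/x)` as `x → 0+`. -/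
theorem stmt_15 (p : ℕ → ℝ) (hpos : ∀ j, 0 < p j) (hmono : Antitone p)
    (hsum : ∑' j, p j = 1) :
    (∀ ℓ : ℝ → ℝ, Measurable ℓ → (∀ y : ℝ, 0 < y → 0 < ℓ y) → SlowlyVarying ℓ →
      Tendsto (fun x : ℝ => nubar p x / (x⁻¹ * ℓ (1 / x))) (𝓝[>] 0) (𝓝 1) →
      (∃ y₀ : ℝ, 0 < y₀ ∧ ∀ y : ℝ, y₀ ≤ y →
        IntegrableOn (fun u : ℝ => ℓ u / u) (Set.Ioi y)) ∧
      SlowlyVarying (ellOne ℓ) ∧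
      Tendsto (fun y : ℝ => ℓ y / ellOne ℓ y) atTop (𝓝 0) ∧
      Tendsto (fun x : ℝ => nuR p 1 x / ellOne ℓ (1 / x)) (𝓝[>] 0) (𝓝 1) ∧
      (∀ r : ℕ, 1 < r →
        Tendsto
          (fun x : ℝ => nuR p r x / (1 / ((r : ℝ) - 1) * x ^ ((r : ℝ) - 1) * ℓ (1 / x)))
          (𝓝[>] 0) (𝓝 1))) ∧
    (∀ ℓ₁ : ℝ → ℝ, (∀ y : ℝ, 0 < y → 0 < ℓ₁ y) → SlowlyVarying ℓ₁ →
      Tendsto (fun x : ℝ => nuR p 1 x / ℓ₁ (1 / x)) (𝓝[>] 0) (𝓝 1) →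
      Tendsto (fun x : ℝ => x * nubar p x / ℓ₁ (1 / x)) (𝓝[>] 0) (𝓝 0)) := by

  have hs : Summable p := by
    by_contra h
    rw [tsum_eq_zero_of_not_summable h] at hsum
    exact zero_ne_one hsum
  constructor
  · intro ℓ hm hl hsv hN
    have hL : Tendsto (fun y => MM p y / (y * ℓ y)) atTop (𝓝 1) := by
      refine (from_zero hN).congr' ?_
      filter_upwards [eventually_gt_atTop 0] with y hy
      rw [nubar_eq y hy]
      simp
    have hM : ∀ c : ℝ, 0 < c → Tendsto (fun y => MM p (c * y) / MM p y) atTop (𝓝 c) := by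
      intro c hc
      have h1 := hL.comp (tendsto_id.const_mul_atTop hc)
      have h2 := (((h1.mul (hsv c hc)).mul_const c).div hL one_ne_zero)
      rw [mul_one, one_mul, div_one] at h2
      refine h2.congr' ?_
      filter_upwards [eventually_gt_atTop 0, MM_pos hpos hs] with y hy hmy
      have a1 := hl y hy
      have a2 := hl (c * y) (by positivity)
      simp only [Function.comp, id, Pi.div_apply]
      field_simp
    have hA := asym1 hpos hs hM
    have hE := ell_asym hpos hs hm hl hL
    have hS := asym3 hpos hs hM
    refine ⟨ell_int hpos hs hm hl hL, ?_, ?_, ?_, ?_⟩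
    · intro c hc
      have h1 := hE.comp (tendsto_id.const_mul_atTop hc)
      have h2 := ((h1.mul (asym2 hpos hs hM c hc)).div hE one_ne_zero)
      rw [mul_one, div_one] at h2
      refine h2.congr' ?_
      filter_upwards [eventually_gt_atTop 0] with y hy
      have g1 := GG_pos hpos hs le_rfl hy
      have g2 := GG_pos hpos hs le_rfl (y := c * y) (by positivity)
      simp only [Function.comp, id, Pi.div_apply]
      field_simp
    · have h2 := (hA.div hL one_ne_zero).div hE one_ne_zero
      rw [zero_div, zero_div] at h2
      refine h2.congr' ?_
      filter_upwards [eventually_gt_atTop 0, MM_pos hpos hs] with y hy hmy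
      have g1 := GG_pos hpos hs le_rfl hy
      have a1 := hl y hy
      simp only [Pi.div_apply]
      field_simp
    · refine to_zero ?_
      have h2 := ((hS.mul hA).const_sub 1).div hE one_ne_zero
      rw [mul_zero, sub_zero, div_one] at h2
      refine h2.congr' ?_
      filter_upwards [eventually_gt_atTop 0, MM_pos hpos hs] with y hy hmy
      have g1 := GG_pos hpos hs le_rfl hy
      rw [nuR_eq hpos hs le_rfl hy, one_div_one_div]
      simp only [Pi.div_apply]
      field_simp
    · intro r hr
      have hr' : (2 : ℝ) ≤ r := by exact_mod_cast hr
      have hr1 : (r : ℝ) - 1 ≠ 0 := by linarith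
      refine to_zero ?_
      have h2 := (((karamata hpos hs hM r hr).sub hS).mul_const ((r : ℝ) - 1)).mul hL
      have e : ((r : ℝ) / (r - 1) - 1) * (r - 1) * 1 = 1 := by field_simp; ring
      rw [e] at h2
      refine h2.congr' ?_
      filter_upwards [eventually_gt_atTop 0, MM_pos hpos hs] with y hy hmy
      have a1 := hl y hy
      rw [nuR_eq hpos hs hr.le hy, one_div_one_div]
      have e2 : (1 / y) ^ ((r : ℝ) - 1) = y / y ^ r := by
        rw [Real.rpow_sub_one (by positivity), Real.rpow_natCast, one_div, inv_pow]
        field_simp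
      rw [e2]
      simp only [one_div, inv_pow]
      field_simp
  · intro ℓ₁ hl hsv hN
    have hL := from_zero hN
    simp only [one_div_one_div] at hL
    have hV : ∀ c : ℝ, 0 < c →
        Tendsto (fun y => nuR p 1 (1 / (c * y)) / nuR p 1 (1 / y)) atTop (𝓝 1) := by
      intro c hc
      have h1 := hL.comp (tendsto_id.const_mul_atTop hc)
      have h2 := (h1.mul (hsv c hc)).div hL one_ne_zero
      rw [mul_one, div_one] at h2
      refine h2.congr' ?_
      filter_upwards [eventually_gt_atTop 0] with y hy
      have a1 := hl y hy
      have a2 := hl (c * y) (by positivity)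
      simp only [Function.comp, id, Pi.div_apply]
      field_simp
    refine to_zero ?_
    have h2 := (V_main hpos hs hV).mul hL
    rw [zero_mul] at h2
    refine h2.congr' ?_
    filter_upwards [eventually_gt_atTop 0] with y hy
    have a1 := hl y hy
    have a2 := V_pos hpos hs (x := 1 / y) (by positivity)
    rw [nubar_eq y hy, one_div_one_div]
    generalize nuR p 1 (1 / y) = V at *
    field_simp
end
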